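/- Let A be a symmetric k-weak-pebble hesitant alternating tree automaton with n states. If L(A) ≠ ∅, then A accepts a tree whose branching degree is at most 2^{n²·(k+1)}. -/

import Mathlib

/-- Trees / run trees: prefix-closed, sibling-downward-closed subsets of ℕ*. -/
def IsTree (T : Set (List ℕ)) : Prop :=
  [] ∈ T ∧ (∀ x : List ℕ, ∀ c : ℕ, x ++ [c] ∈ T → x ∈ T) ∧
    (∀ x : List ℕ, ∀ c c' : ℕ, x ++ [c] ∈ T → c' < c → x ++ [c'] ∈ T)

inductive AClass where
  | existential | universal | transient
deriving DecidableEq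

/-- Positive Boolean formulas. -/
inductive PosBool (X : Type) where
  | tt | ff
  | var (x : X)
  | and (a b : PosBool X)
  | or (a b : PosBool X)

def PosBool.Sat {X : Type} (v : X → Prop) : PosBool X → Prop
  | .tt => True
  | .ff => False
  | .var x => v x
  | .and a b => a.Sat v ∧ b.Sat v
  | .or a b => a.Sat v ∨ b.Sat v

def PosBool.vars {X : Type} : PosBool X → List X
  | .tt => []
  | .ff => []
  | .var x => [x]
  | .and a b => a.vars ++ b.vars
  | .or a b => a.vars ++ b.vars

/-- All `P`-atoms of the formula are only disjunctively related. -/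
def DisjOnly {X : Type} (P : X → Prop) : PosBool X → Prop
  | .tt => True
  | .ff => True
  | .var _ => True
  | .and a b => DisjOnly P a ∧ DisjOnly P b ∧
      ((∀ x ∈ a.vars, ¬ P x) ∨ (∀ x ∈ b.vars, ¬ P x))
  | .or a b => DisjOnly P a ∧ DisjOnly P b

/-- All `P`-atoms of the formula are only conjunctively related. -/
def ConjOnly {X : Type} (P : X → Prop) : PosBool X → Prop
  | .tt => True
  | .ff => True
  | .var _ => True
  | .or a b => ConjOnly P a ∧ ConjOnly P b ∧
      ((∀ x ∈ a.vars, ¬ P x) ∨ (∀ x ∈ b.vars, ¬ P x))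
  | .and a b => ConjOnly P a ∧ ConjOnly P b

/-- Moves of a symmetric automaton: `□` (all children), `◇` (some child),
parent (`-1`), stay (`0`), root test. -/
inductive SMove where
  | box | dia | up | stay | root
deriving DecidableEq

/-- The possible values of the transition function. -/
inductive ATrans (Q : Type) where
  | drop (q : Q)
  | lift (q : Q)
  | form (φ : PosBool (SMove × Q))

def ATrans.states {Q : Type} : ATrans Q → List Q
  | .drop q => [q]
  | .lift q => [q]
  | .form φ => φ.vars.map Prod.snd

/-- A symmetric `k`-weak-pebble hesitant alternating tree automaton. -/
structure SWPHAA (Q σ : Type) (k : ℕ) where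
  q0 : Q
  δ : Q → σ → Bool → ATrans Q
  idx : Q → ℕ
  cls : ℕ → AClass
  G : Set Q
  B : Set Q

/-- Syntactic restrictions of Definition 2.3. -/
def WellFormed {Q σ : Type} {k : ℕ} (A : SWPHAA Q σ k) : Prop :=
  (∀ q s p, A.δ q s false ≠ .lift p) ∧
  (∀ q s φ, A.δ q s true = .form φ → ∀ mp ∈ φ.vars, mp.1 ≠ SMove.up)

/-- The hesitancy conditions, including the symmetric requirement that
existential (universal) classes use no `□` (`◇`) moves inside the class. -/
def Hesitant {Q σ : Type} {k : ℕ} (A : SWPHAA Q σ k) : Prop :=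
  (∀ q s b, ∀ p ∈ (A.δ q s b).states, A.idx p ≤ A.idx q) ∧
  (∀ q s b, A.cls (A.idx q) = .transient →
    ∀ p ∈ (A.δ q s b).states, A.idx p ≠ A.idx q) ∧
  (∀ q s b φ, A.cls (A.idx q) = .existential → A.δ q s b = .form φ →
    DisjOnly (fun mp : SMove × Q => A.idx mp.2 = A.idx q) φ ∧
      ∀ p : Q, (SMove.box, p) ∈ φ.vars → A.idx p ≠ A.idx q) ∧
  (∀ q s b φ, A.cls (A.idx q) = .universal → A.δ q s b = .form φ →
    ConjOnly (fun mp : SMove × Q => A.idx mp.2 = A.idx q) φ ∧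
      ∀ p : Q, (SMove.dia, p) ∈ φ.vars → A.idx p ≠ A.idx q)

/-- A configuration: state, current node, stack of placed pebbles. -/
structure Config (Q : Type) where
  st : Q
  pos : List ℕ
  peb : List (List ℕ)
deriving DecidableEq

def HasChild {Q : Type} (R : Set (List ℕ)) (ℓ : List ℕ → Config Q)
    (v : List ℕ) (c : Config Q) : Prop :=
  ∃ j : ℕ, v ++ [j] ∈ R ∧ ℓ (v ++ [j]) = c

def MoveOK {Q : Type} (T R : Set (List ℕ)) (ℓ : List ℕ → Config Q)
    (v x : List ℕ) (peb : List (List ℕ)) : SMove × Q → Prop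
  | (SMove.box, p) => ∀ c : ℕ, x ++ [c] ∈ T → HasChild R ℓ v ⟨p, x ++ [c], peb⟩
  | (SMove.dia, p) => ∃ c : ℕ, x ++ [c] ∈ T ∧ HasChild R ℓ v ⟨p, x ++ [c], peb⟩
  | (SMove.up, p) => x ≠ [] ∧ peb.getLast? ≠ some x ∧
      HasChild R ℓ v ⟨p, x.dropLast, peb⟩
  | (SMove.stay, p) => HasChild R ℓ v ⟨p, x, peb⟩
  | (SMove.root, p) => x = [] ∧ HasChild R ℓ v ⟨p, x, peb⟩

/-- The node `v` of the run is compatible with the transition function. -/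
def LocalOK {Q σ : Type} {k : ℕ} (A : SWPHAA Q σ k) (T : Set (List ℕ))
    (V : List ℕ → σ) (R : Set (List ℕ)) (ℓ : List ℕ → Config Q)
    (v : List ℕ) : Prop :=
  (ℓ v).pos ∈ T ∧ (ℓ v).peb.length ≤ k ∧
    match A.δ (ℓ v).st (V (ℓ v).pos)
        (decide ((ℓ v).peb.getLast? = some (ℓ v).pos)) with
    | .drop p => (ℓ v).peb.length < k ∧
        HasChild R ℓ v ⟨p, (ℓ v).pos, (ℓ v).peb ++ [(ℓ v).pos]⟩
    | .lift p => (ℓ v).peb.getLast? = some (ℓ v).pos ∧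
        HasChild R ℓ v ⟨p, (ℓ v).pos, (ℓ v).peb.dropLast⟩
    | .form φ => ∃ Y : Set (SMove × Q), PosBool.Sat (· ∈ Y) φ ∧
        ∀ mp ∈ Y, MoveOK T R ℓ v (ℓ v).pos (ℓ v).peb mp

/-- A run of `A` on `(T,V)`. -/
def IsRun {Q σ : Type} {k : ℕ} (A : SWPHAA Q σ k) (T : Set (List ℕ))
    (V : List ℕ → σ) (R : Set (List ℕ)) (ℓ : List ℕ → Config Q) : Prop :=
  IsTree R ∧ ℓ [] = ⟨A.q0, [], []⟩ ∧ ∀ v ∈ R, LocalOK A T V R ℓ v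

def InfBranch (R : Set (List ℕ)) (b : ℕ → List ℕ) : Prop :=
  b 0 = [] ∧ ∀ n, b n ∈ R ∧ ∃ c : ℕ, b (n + 1) = b n ++ [c]

/-- The hesitant acceptance condition on an infinite sequence of states. -/
def AccBranch {Q σ : Type} {k : ℕ} (A : SWPHAA Q σ k) (s : ℕ → Q) : Prop :=
  ∃ i N, (∀ n, N ≤ n → A.idx (s n) = i) ∧
    ((A.cls i = .existential ∧ ∀ m, ∃ n, m ≤ n ∧ s n ∈ A.G) ∨
     (A.cls i = .universal ∧ ∃ m, ∀ n, m ≤ n → s n ∉ A.B))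

def TrueApplies {Q σ : Type} {k : ℕ} (A : SWPHAA Q σ k)
    (V : List ℕ → σ) (ℓ : List ℕ → Config Q) (v : List ℕ) : Prop :=
  match A.δ (ℓ v).st (V (ℓ v).pos)
      (decide ((ℓ v).peb.getLast? = some (ℓ v).pos)) with
  | .form φ => PosBool.Sat (fun _ => False) φ
  | _ => False

def Accepting {Q σ : Type} {k : ℕ} (A : SWPHAA Q σ k) (T : Set (List ℕ))
    (V : List ℕ → σ) (R : Set (List ℕ)) (ℓ : List ℕ → Config Q) : Prop :=
  (∀ b : ℕ → List ℕ, InfBranch R b → AccBranch A (fun n => (ℓ (b n)).st)) ∧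
  (∀ v ∈ R, (∀ j : ℕ, v ++ [j] ∉ R) → TrueApplies A V ℓ v)

/-- `A` accepts the labeled tree `(T,V)`. -/
def SAccepts {Q σ : Type} {k : ℕ} (A : SWPHAA Q σ k) (T : Set (List ℕ))
    (V : List ℕ → σ) : Prop :=
  ∃ R ℓ, IsRun A T V R ℓ ∧ Accepting A T V R ℓ


/-! ### Part 1: basic notions -/

/-- The transition applied in configuration `c`. -/
def trn {Q σ : Type} {k : ℕ} (A : SWPHAA Q σ k) (V : List ℕ → σ) (c : Config Q) : ATrans Q :=
  A.δ c.st (V c.pos) (decide (c.peb.getLast? = some c.pos))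

def MoveX {Q : Type} (T : Set (List ℕ)) (H : Config Q → Prop) (x : List ℕ)
    (peb : List (List ℕ)) : SMove × Q → Prop
  | (SMove.box, p) => ∀ c : ℕ, x ++ [c] ∈ T → H ⟨p, x ++ [c], peb⟩
  | (SMove.dia, p) => ∃ c : ℕ, x ++ [c] ∈ T ∧ H ⟨p, x ++ [c], peb⟩
  | (SMove.up, p) => x ≠ [] ∧ peb.getLast? ≠ some x ∧ H ⟨p, x.dropLast, peb⟩
  | (SMove.stay, p) => H ⟨p, x, peb⟩
  | (SMove.root, p) => x = [] ∧ H ⟨p, x, peb⟩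

def LocX {Q σ : Type} {k : ℕ} (A : SWPHAA Q σ k) (T : Set (List ℕ))
    (V : List ℕ → σ) (H : Config Q → Prop) (c : Config Q) : Prop :=
  c.pos ∈ T ∧ c.peb.length ≤ k ∧
    (∀ p, trn A V c = .drop p → c.peb.length < k ∧ H ⟨p, c.pos, c.peb ++ [c.pos]⟩) ∧
    (∀ p, trn A V c = .lift p → c.peb.getLast? = some c.pos ∧ H ⟨p, c.pos, c.peb.dropLast⟩) ∧
    (∀ φ, trn A V c = .form φ → ∃ Y : Set (SMove × Q), PosBool.Sat (· ∈ Y) φ ∧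
        ∀ mp ∈ Y, MoveX T H c.pos c.peb mp)

theorem localOK_iff {Q σ : Type} {k : ℕ} (A : SWPHAA Q σ k) (T : Set (List ℕ))
    (V : List ℕ → σ) (R : Set (List ℕ)) (ℓ : List ℕ → Config Q) (v : List ℕ) :
    LocalOK A T V R ℓ v ↔ LocX A T V (HasChild R ℓ v) (ℓ v) := by
  have hM : ∀ mp : SMove × Q, MoveOK T R ℓ v (ℓ v).pos (ℓ v).peb mp ↔
      MoveX T (HasChild R ℓ v) (ℓ v).pos (ℓ v).peb mp := by
    rintro ⟨m, p⟩
    cases m <;> simp [MoveOK, MoveX]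
  unfold LocalOK LocX
  refine and_congr_right fun _ => and_congr_right fun _ => ?_
  simp only [hM]
  change (match trn A V (ℓ v) with
    | .drop p => _
    | .lift p => _
    | .form φ => _) ↔ _
  cases h : trn A V (ℓ v) <;> simp

/-- `true` applies. -/
def TA {Q σ : Type} {k : ℕ} (A : SWPHAA Q σ k) (V : List ℕ → σ) (c : Config Q) : Prop :=
  ∃ φ, trn A V c = .form φ ∧ PosBool.Sat (fun _ => False) φ

theorem trueApplies_iff {Q σ : Type} {k : ℕ} (A : SWPHAA Q σ k)
    (V : List ℕ → σ) (ℓ : List ℕ → Config Q) (v : List ℕ) :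
    TrueApplies A V ℓ v ↔ TA A V (ℓ v) := by
  unfold TrueApplies TA
  change (match trn A V (ℓ v) with
    | .form φ => _
    | _ => _) ↔ _
  cases h : trn A V (ℓ v) <;> simp

theorem PosBool.Sat.mono {X : Type} {v w : X → Prop} {φ : PosBool X}
    (h : PosBool.Sat v φ) (hvw : ∀ x ∈ φ.vars, v x → w x) : PosBool.Sat w φ := by
  induction φ with
  | tt => trivial
  | ff => exact h
  | var x => exact hvw x (by simp [PosBool.vars]) h
  | and a b iha ihb =>
    simp only [PosBool.vars, List.mem_append] at hvw
    exact ⟨iha h.1 fun x hx => hvw x (Or.inl hx), ihb h.2 fun x hx => hvw x (Or.inr hx)⟩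
  | or a b iha ihb =>
    simp only [PosBool.vars, List.mem_append] at hvw
    exact h.imp (fun h => iha h fun x hx => hvw x (Or.inl hx))
      (fun h => ihb h fun x hx => hvw x (Or.inr hx))

instance configCountable {Q : Type} [Countable Q] : Countable (Config Q) := by
  have : Function.Injective (fun c : Config Q => (c.st, c.pos, c.peb)) := by
    rintro ⟨a, b, c⟩ ⟨a', b', c'⟩ h
    simpa using h
  exact this.countable

/-! ### Part 2: unravelling a graph of abstract states into a run -/

theorem unravel {Q σ : Type} {k : ℕ} (A : SWPHAA Q σ k) (T : Set (List ℕ))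
    (V : List ℕ → σ) {X : Type} [Countable X] (cfg : X → Config Q) (Nx : X → X → Prop)
    (x0 : X) (P : X → Prop) (hP0 : P x0) (hP : ∀ a b, P a → Nx a b → P b)
    (hcfg0 : cfg x0 = ⟨A.q0, [], []⟩)
    (hloc : ∀ a, P a → LocX A T V (fun c => ∃ b, Nx a b ∧ cfg b = c) (cfg a))
    (hacc : ∀ f : ℕ → X, f 0 = x0 → (∀ n, P (f n)) → (∀ n, Nx (f n) (f (n + 1))) →
      AccBranch A (fun n => (cfg (f n)).st))
    (hdead : ∀ a, P a → (∀ b, ¬ Nx a b) → TA A V (cfg a)) : SAccepts A T V := by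
  have hen : ∀ a, ∃ f : ℕ → X, (∃ b, Nx a b) → ∀ b, Nx a b ↔ ∃ j, f j = b := by
    intro a
    by_cases h : ∃ b, Nx a b
    · obtain ⟨f, hf⟩ := (Set.to_countable {b | Nx a b}).exists_eq_range h
      refine ⟨f, fun _ b => ?_⟩
      have : b ∈ {b | Nx a b} ↔ b ∈ Set.range f := by rw [hf]
      simpa using this
    · exact ⟨fun _ => a, fun h' => absurd h' h⟩
  choose en hen using hen
  let lab : List ℕ → X := fun v => v.foldl en x0
  have lab_app : ∀ v j, lab (v ++ [j]) = en (lab v) j := by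
    intro v j
    simp [lab, List.foldl_append]
  let R : Set (List ℕ) := {v | ∀ u j, u ++ [j] <+: v → ∃ b, Nx (lab u) b}
  have R_app : ∀ v j, v ++ [j] ∈ R ↔ v ∈ R ∧ ∃ b, Nx (lab v) b := by
    intro v j
    constructor
    · intro h
      exact ⟨fun u i hu => h u i (hu.trans (List.prefix_append _ _)), h v j (List.prefix_refl _)⟩
    · rintro ⟨h1, h2⟩ u i hu
      rcases List.prefix_concat_iff.1 hu with h | h
      · obtain ⟨rfl, _⟩ := List.append_inj' h rfl
        exact h2
      · exact h1 u i h
  have hRP : ∀ v, v ∈ R → P (lab v) := by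
    intro v
    induction v using List.reverseRecOn with
    | nil => intro _; exact hP0
    | append_singleton v j ih =>
      intro h
      obtain ⟨h1, h2⟩ := (R_app v j).1 h
      rw [lab_app]
      exact hP _ _ (ih h1) ((hen _ h2 _).2 ⟨j, rfl⟩)
  have hch : ∀ v ∈ R, ∀ c, (∃ b, Nx (lab v) b ∧ cfg b = c) →
      HasChild R (fun v => cfg (lab v)) v c := by
    rintro v hv c ⟨b, hb, rfl⟩
    obtain ⟨j, hj⟩ := (hen _ ⟨b, hb⟩ b).1 hb
    exact ⟨j, (R_app v j).2 ⟨hv, b, hb⟩, by simp only [lab_app, hj]⟩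
  refine ⟨R, fun v => cfg (lab v), ⟨⟨?_, ?_, ?_⟩, hcfg0, ?_⟩, ?_, ?_⟩
  · intro u j hu
    simp at hu
  · intro x c h
    exact ((R_app x c).1 h).1
  · intro x c c' h _
    exact (R_app x c').2 ((R_app x c).1 h)
  · intro v hv
    rw [localOK_iff]
    obtain ⟨h1, h2, h3, h4, h5⟩ := hloc _ (hRP v hv)
    refine ⟨h1, h2, fun p hp => ⟨(h3 p hp).1, hch v hv _ (h3 p hp).2⟩,
      fun p hp => ⟨(h4 p hp).1, hch v hv _ (h4 p hp).2⟩, fun φ hφ => ?_⟩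
    obtain ⟨Y, hY, hM⟩ := h5 φ hφ
    refine ⟨Y, hY, ?_⟩
    rintro ⟨m, p⟩ hmp
    have := hM _ hmp
    cases m
    · exact fun c hc => hch v hv _ (this c hc)
    · obtain ⟨c, hc, h⟩ := this
      exact ⟨c, hc, hch v hv _ h⟩
    · exact ⟨this.1, this.2.1, hch v hv _ this.2.2⟩
    · exact hch v hv _ this
    · exact ⟨this.1, hch v hv _ this.2⟩
  · intro b hb
    refine hacc (fun n => lab (b n)) (by simp [hb.1, lab]) (fun n => hRP _ (hb.2 n).1) ?_
    intro n
    obtain ⟨c, hc⟩ := (hb.2 n).2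
    have h1 := (hb.2 (n + 1)).1
    rw [hc] at h1
    obtain ⟨_, h2⟩ := (R_app _ _).1 h1
    simp only [hc, lab_app]
    exact (hen _ h2 _).2 ⟨c, rfl⟩
  · intro v hv hno
    rw [trueApplies_iff]
    refine hdead _ (hRP v hv) fun b hb => hno 0 ((R_app v 0).2 ⟨hv, b, hb⟩)


/-! ### Part 3: renumbering the children of a tree -/

open Classical in
noncomputable def rnAux (T : Set (List ℕ)) : List ℕ → List ℕ → List ℕ
  | _, [] => []
  | u, c :: x => Nat.count (fun i => u ++ [i] ∈ T) c :: rnAux T (u ++ [c]) x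

open Classical in
theorem rnAux_append (T : Set (List ℕ)) (u x : List ℕ) (c : ℕ) :
    rnAux T u (x ++ [c]) = rnAux T u x ++ [Nat.count (fun i => (u ++ x) ++ [i] ∈ T) c] := by
  induction x generalizing u with
  | nil => simp [rnAux]
  | cons a x ih => simp [rnAux, ih]

theorem rnAux_length (T : Set (List ℕ)) (u x : List ℕ) : (rnAux T u x).length = x.length := by
  induction x generalizing u with
  | nil => simp [rnAux]
  | cons a x ih => simp [rnAux, ih]

theorem rnAux_inj (T : Set (List ℕ)) (hpre : ∀ x c, x ++ [c] ∈ T → x ∈ T) :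
    ∀ x y, x ∈ T → y ∈ T → rnAux T [] x = rnAux T [] y → x = y := by
  intro x
  induction x using List.reverseRecOn with
  | nil =>
    intro y _ _ h
    have := congrArg List.length h
    rw [rnAux_length, rnAux_length] at this
    exact (List.eq_nil_of_length_eq_zero this.symm).symm
  | append_singleton x c ih =>
    intro y hx hy h
    rcases List.eq_nil_or_concat y with rfl | ⟨y, d, rfl⟩
    · have := congrArg List.length h
      rw [rnAux_length, rnAux_length] at this
      simp at this
    · rw [List.concat_eq_append] at *
      rw [rnAux_append, rnAux_append] at h
      obtain ⟨h1, h2⟩ := List.append_inj' h rfl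
      obtain rfl := ih y (hpre _ _ hx) (hpre _ _ hy) h1
      simp only [List.nil_append, List.cons.injEq, and_true] at h2
      classical
      have hcd : c = d := Nat.count_injective (p := fun i => x ++ [i] ∈ T) hx hy (by convert h2)
      rw [hcd]

theorem count_surj (p : ℕ → Prop) [DecidablePred p] (c m : ℕ) (hm : m < Nat.count p c) :
    ∃ d, p d ∧ Nat.count p d = m := by
  induction c with
  | zero => simp at hm
  | succ c ih =>
    rw [Nat.count_succ] at hm
    split_ifs at hm with h
    · rcases Nat.lt_succ_iff_lt_or_eq.1 hm with h' | h'
      · exact ih h'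
      · exact ⟨c, h, h'.symm⟩
    · exact ih hm

theorem renumber {Q σ : Type} {k : ℕ} (A : SWPHAA Q σ k) (T : Set (List ℕ))
    (V : List ℕ → σ) (N : ℕ) (hnil : [] ∈ T) (hpre : ∀ x c, x ++ [c] ∈ T → x ∈ T)
    (hdeg : ∀ x, ∃ D : Finset ℕ, D.card ≤ N ∧ ∀ c, x ++ [c] ∈ T → c ∈ D)
    (h : SAccepts A T V) :
    ∃ T' V', IsTree T' ∧ SAccepts A T' V' ∧ ∀ x : List ℕ, x ++ [N] ∉ T' := by
  classical
  have hinj := rnAux_inj T hpre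
  set T' : Set (List ℕ) := rnAux T [] '' T with hT'
  have hsplit : ∀ x' c', x' ++ [c'] ∈ T' → ∃ x c, x ++ [c] ∈ T ∧ rnAux T [] x = x' ∧
      Nat.count (fun i => x ++ [i] ∈ T) c = c' := by
    rintro x' c' ⟨y, hy, hyx⟩
    rcases List.eq_nil_or_concat y with rfl | ⟨y, d, rfl⟩
    · simp [rnAux] at hyx
    · rw [List.concat_eq_append] at *
      rw [rnAux_append] at hyx
      obtain ⟨h1, h2⟩ := List.append_inj' hyx rfl
      refine ⟨y, d, hy, h1, ?_⟩
      simp only [List.nil_append, List.cons.injEq, and_true] at h2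
      convert h2
  have hN : ∀ x, x ++ [N] ∉ T' := by
    intro x' hx'
    obtain ⟨x, c, hx, -, hc⟩ := hsplit _ _ hx'
    obtain ⟨D, hD, hcD⟩ := hdeg x
    have h1 : Nat.count (fun i => x ++ [i] ∈ T) (c + 1) = N + 1 := by
      rw [Nat.count_succ, if_pos hx, hc]
    rw [Nat.count_eq_card_filter_range] at h1
    have h2 : (Finset.filter (fun i => x ++ [i] ∈ T) (Finset.range (c + 1))).card ≤ D.card :=
      Finset.card_le_card fun i hi => hcD i (Finset.mem_filter.1 hi).2
    omega
  set e : List ℕ → List ℕ := fun x => if x ∈ T then rnAux T [] x else [N] with he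
  have heT : ∀ x ∈ T, e x = rnAux T [] x := fun x hx => by simp [he, hx]
  have hechild : ∀ x c, x ++ [c] ∈ T → e (x ++ [c]) ∈ T' ∧ ∃ c', e (x ++ [c]) = e x ++ [c'] := by
    intro x c hx
    refine ⟨⟨_, hx, (heT _ hx).symm⟩, ?_⟩
    rw [heT _ hx, heT _ (hpre _ _ hx), rnAux_append]
    exact ⟨_, rfl⟩
  have heq : ∀ z, ∀ x ∈ T, e z = e x ↔ z = x := by
    intro z x hx
    constructor
    · intro hzx
      by_cases hz : z ∈ T
      · rw [heT _ hz, heT _ hx] at hzx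
        exact hinj _ _ hz hx hzx
      · exfalso
        rw [heT _ hx] at hzx
        simp only [he, hz, if_false] at hzx
        exact hN [] ⟨x, hx, by simpa using hzx.symm⟩
    · rintro rfl; rfl
  have heinv : ∀ x', ∃ x, x' ∈ T' → x ∈ T ∧ e x = x' := by
    intro x'
    by_cases hx' : x' ∈ T'
    · obtain ⟨x, hx, h⟩ := hx'
      exact ⟨x, fun _ => ⟨hx, (heT _ hx).trans h⟩⟩
    · exact ⟨[], fun h => absurd h hx'⟩
  choose g hg using heinv
  have hge : ∀ x ∈ T, g (e x) = x := by
    intro x hx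
    obtain ⟨h1, h2⟩ := hg (e x) ⟨x, hx, (heT _ hx).symm⟩
    exact (heq _ _ hx).1 h2
  obtain ⟨R, ℓ, ⟨hR, h0, hl⟩, hb, hd⟩ := h
  let m : Config Q → Config Q := fun c => ⟨c.st, e c.pos, c.peb.map e⟩
  have hlast : ∀ c : Config Q, c.pos ∈ T →
      ((m c).peb.getLast? = some (m c).pos ↔ c.peb.getLast? = some c.pos) := by
    intro c hc
    simp only [m, List.getLast?_map]
    cases c.peb.getLast? with
    | none => simp
    | some z => simp [heq z _ hc]
  have htr : ∀ c : Config Q, c.pos ∈ T → trn A (fun x => V (g x)) (m c) = trn A V c := by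
    intro c hc
    unfold trn
    have : decide ((m c).peb.getLast? = some (m c).pos) =
        decide (c.peb.getLast? = some c.pos) := by
      simp only [hlast c hc]
    rw [this]
    simp [m, hge _ hc]
  have hchild : ∀ v c, HasChild R ℓ v c → HasChild R (fun v => m (ℓ v)) v (m c) := by
    rintro v c ⟨j, hj, rfl⟩
    exact ⟨j, hj, rfl⟩
  refine ⟨T', fun x => V (g x), ⟨⟨[], hnil, by simp [rnAux]⟩, ?_, ?_⟩,
    ⟨R, fun v => m (ℓ v), ⟨hR, ?_, ?_⟩, ?_, ?_⟩, hN⟩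
  · intro x' c' hx'
    obtain ⟨x, c, hx, h1, -⟩ := hsplit _ _ hx'
    exact ⟨x, hpre _ _ hx, h1⟩
  · intro x' c' d' hx' hlt
    obtain ⟨x, c, hx, h1, h2⟩ := hsplit _ _ hx'
    obtain ⟨d, hd1, hd2⟩ := count_surj (fun i => x ++ [i] ∈ T) c d' (h2 ▸ hlt)
    refine ⟨x ++ [d], hd1, ?_⟩
    rw [rnAux_append, h1]
    simp only [List.nil_append, List.append_cancel_left_eq, List.cons.injEq, and_true]
    convert hd2
  · simp [m, h0, heT _ hnil, rnAux]
  · intro v hv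
    have := hl v hv
    rw [localOK_iff] at this ⊢
    obtain ⟨h1, h2, h3, h4, h5⟩ := this
    have htr' := htr _ h1
    refine ⟨⟨_, h1, (heT _ h1).symm⟩, by simpa [m] using h2, ?_, ?_, ?_⟩
    · intro p hp
      rw [htr'] at hp
      obtain ⟨h6, h7⟩ := h3 p hp
      refine ⟨by simpa [m] using h6, ?_⟩
      have := hchild _ _ h7
      simpa [m] using this
    · intro p hp
      rw [htr'] at hp
      obtain ⟨h6, h7⟩ := h4 p hp
      refine ⟨(hlast _ h1).2 h6, ?_⟩
      have := hchild _ _ h7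
      simpa [m, List.map_dropLast] using this
    · intro φ hφ
      rw [htr'] at hφ
      obtain ⟨Y, hY, hM⟩ := h5 φ hφ
      refine ⟨Y, hY, ?_⟩
      rintro ⟨mv, p⟩ hmp
      have hm := hM _ hmp
      cases mv
      · intro c' hc'
        obtain ⟨x, c, hx, hx1, hx2⟩ := hsplit _ _ hc'
        have hxe : x = (ℓ v).pos := by
          rw [← heT _ (hpre _ _ hx)] at hx1
          exact (heq _ _ h1).1 hx1
        subst hxe
        have := hchild _ _ (hm c hx)
        have he2 : e ((ℓ v).pos ++ [c]) = e (ℓ v).pos ++ [c'] := by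
          rw [heT _ hx, heT _ h1, rnAux_append, List.append_cancel_left_eq]
          simp only [List.nil_append, List.cons.injEq, and_true]
          convert hx2
        simpa only [m, he2] using this
      · obtain ⟨c, hc, hcc⟩ := hm
        obtain ⟨hc1, c', hc2⟩ := hechild _ _ hc
        refine ⟨c', by rw [← hc2]; exact hc1, ?_⟩
        have := hchild _ _ hcc
        simpa only [m, hc2] using this
      · obtain ⟨hm1, hm2, hm3⟩ := hm
        rcases List.eq_nil_or_concat (ℓ v).pos with h | ⟨x, c, hxc⟩
        · exact absurd h hm1
        · rw [List.concat_eq_append] at hxc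
          have hxT : x ++ [c] ∈ T := hxc ▸ h1
          obtain ⟨hc1, c', hc2⟩ := hechild _ _ hxT
          have hpos : (m (ℓ v)).pos = e x ++ [c'] := by
            simp only [m, hxc, hc2]
          refine ⟨by rw [hpos]; simp, fun h => hm2 ((hlast _ h1).1 h), ?_⟩
          have := hchild _ _ hm3
          rw [hpos]
          rw [hxc] at this
          simpa only [m, List.dropLast_concat] using this
      · exact hchild _ _ hm
      · refine ⟨?_, hchild _ _ hm.2⟩
        have : (ℓ v).pos = [] := hm.1
        simp [m, this, heT _ hnil, rnAux]
  · intro b hb'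
    exact hb b hb'
  · intro v hv hno
    have := hd v hv hno
    rw [trueApplies_iff] at this ⊢
    have h1 := ((localOK_iff A T V R ℓ v).1 (hl v hv)).1
    unfold TA at *
    rw [htr _ h1]
    exact this

/-! ### Part 4: the combinatorial rank argument for stack-like sequences -/

theorem stack_rank_level (h : ℕ → ℕ) (a : ℕ → Ordinal.{0}) (f : ℕ → Prop)
    (H0 : ∀ n, h (n + 1) = h n ∨ h (n + 1) = h n + 1 ∨ h n = h (n + 1) + 1)
    (H1 : ∀ n, h n ≤ h (n + 1) → a (n + 1) ≤ a n ∧ (f n → a (n + 1) < a n))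
    (H3 : ∀ u t, u < t → h u = h (t + 1) → h t = h u + 1 → (∀ v, u < v → v ≤ t → h u < h v) →
      a t ≤ a (u + 1) →
      a (t + 1) ≤ a u ∧ ((f u ∨ f t ∨ a t < a (u + 1)) → a (t + 1) < a u)) :
    ∀ t s, s ≤ t → (∀ v, s ≤ v → v ≤ t → h s ≤ h v) → h t = h s →
      a t ≤ a s ∧ ((∃ n, s ≤ n ∧ n < t ∧ f n) → a t < a s) := by
  intro t
  induction t using Nat.strong_induction_on with
  | _ t ih =>
  intro s hst hv heq
  rcases hst.eq_or_lt with rfl | hlt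
  · exact ⟨le_rfl, fun ⟨n, h1, h2, _⟩ => absurd h1 (by omega)⟩
  obtain ⟨t', rfl⟩ : ∃ t', t = t' + 1 := ⟨t - 1, by omega⟩
  have hst' : s ≤ t' := by omega
  have hh := hv t' hst' (by omega)
  rcases H0 t' with h0 | h0 | h0
  · obtain ⟨h1, h2⟩ := ih t' (by omega) s hst' (fun v hv1 hv2 => hv v hv1 (by omega)) (by omega)
    obtain ⟨h3, h4⟩ := H1 t' (by omega)
    refine ⟨h3.trans h1, ?_⟩
    rintro ⟨n, hn1, hn2, hn⟩
    rcases (Nat.lt_succ_iff.1 hn2).eq_or_lt with rfl | hn2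
    · exact (h4 hn).trans_le h1
    · exact h3.trans_lt (h2 ⟨n, hn1, hn2, hn⟩)
  · omega
  · let u := Nat.findGreatest (fun u => s ≤ u ∧ h u = h s) t'
    have hu : s ≤ u ∧ h u = h s :=
      Nat.findGreatest_spec (P := fun u => s ≤ u ∧ h u = h s) hst' ⟨le_rfl, rfl⟩
    have hut : u ≤ t' := Nat.findGreatest_le t'
    have hut' : u < t' := by
      rcases hut.eq_or_lt with h | h
      · rw [h] at hu; omega
      · exact h
    have hgr : ∀ v, u < v → v ≤ t' → h u < h v := by
      intro v hv1 hv2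
      have h1 := hv v (by omega) (by omega)
      have h2 := Nat.findGreatest_is_greatest (P := fun u => s ≤ u ∧ h u = h s) hv1 hv2
      have : h v ≠ h s := fun h => h2 ⟨by omega, h⟩
      omega
    have hu1 : h (u + 1) = h u + 1 := by
      have := hgr (u + 1) (by omega) (by omega)
      rcases H0 u with h | h | h <;> omega
    obtain ⟨a1, a2⟩ := ih u (by omega) s hu.1 (fun v hv1 hv2 => hv v hv1 (by omega)) hu.2
    obtain ⟨b1, b2⟩ := ih t' (by omega) (u + 1) (by omega)
      (fun v hv1 hv2 => by have := hgr v (by omega) hv2; omega) (by omega)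
    obtain ⟨c1, c2⟩ := H3 u t' hut' (by omega) (by omega) hgr b1
    refine ⟨c1.trans a1, ?_⟩
    rintro ⟨n, hn1, hn2, hn⟩
    by_cases hnu : n < u
    · exact c1.trans_lt (a2 ⟨n, hn1, hnu, hn⟩)
    · refine (c2 ?_).trans_le a1
      by_cases h1 : n = u
      · subst h1; exact Or.inl hn
      by_cases h2 : n = t'
      · subst h2; exact Or.inr (Or.inl hn)
      · exact Or.inr (Or.inr (b2 ⟨n, by omega, by omega, hn⟩))

theorem stack_rank (h : ℕ → ℕ) (a : ℕ → Ordinal.{0}) (f : ℕ → Prop)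
    (H0 : ∀ n, h (n + 1) = h n ∨ h (n + 1) = h n + 1 ∨ h n = h (n + 1) + 1)
    (H1 : ∀ n, h n ≤ h (n + 1) → a (n + 1) ≤ a n ∧ (f n → a (n + 1) < a n))
    (H3 : ∀ u t, u < t → h u = h (t + 1) → h t = h u + 1 → (∀ v, u < v → v ≤ t → h u < h v) →
      a t ≤ a (u + 1) →
      a (t + 1) ≤ a u ∧ ((f u ∨ f t ∨ a t < a (u + 1)) → a (t + 1) < a u)) :
    ¬ ∀ m, ∃ n, m ≤ n ∧ f n := by
  intro hinf
  have L := stack_rank_level h a f H0 H1 H3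
  have hfl : ∀ N, ∃ m, N ≤ m ∧ ∀ v, m ≤ v → h m ≤ h v := by
    intro N
    obtain ⟨m, hm, hmin⟩ := (InvImage.wf h Nat.lt_wfRel.wf).has_min {m | N ≤ m} ⟨N, le_refl N⟩
    exact ⟨m, hm, fun v hv => not_lt.1 (hmin v (le_trans hm hv))⟩
  have F : ∀ t s, s ≤ t → (∀ v, s ≤ v → h s ≤ h v) → (∀ v, t ≤ v → h t ≤ h v) →
      a t ≤ a s ∧ ((∃ n, s ≤ n ∧ n < t ∧ f n) → a t < a s) := by
    intro t s hst
    induction hd : t - s using Nat.strong_induction_on generalizing s with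
    | _ d ih =>
    intro hs ht
    rcases (hs t hst).eq_or_lt with heq | hlt
    · exact L t s hst (fun v hv _ => hs v hv) heq.symm
    · let u := Nat.findGreatest (fun u => s ≤ u ∧ h u = h s) t
      have hu : s ≤ u ∧ h u = h s :=
        Nat.findGreatest_spec (P := fun u => s ≤ u ∧ h u = h s) hst ⟨le_rfl, rfl⟩
      have hut : u ≤ t := Nat.findGreatest_le t
      have hut' : u < t := by
        rcases hut.eq_or_lt with h | h
        · rw [h] at hu; omega
        · exact h
      have hgr : ∀ v, u < v → h u < h v := by
        intro v hv1
        by_cases hv2 : v ≤ t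
        · have h1 := hs v (by omega)
          have h2 := Nat.findGreatest_is_greatest (P := fun u => s ≤ u ∧ h u = h s) hv1 hv2
          have : h v ≠ h s := fun h => h2 ⟨by omega, h⟩
          omega
        · have := ht v (by omega)
          omega
      have hu1 : h (u + 1) = h u + 1 := by
        have := hgr (u + 1) (by omega)
        rcases H0 u with h | h | h <;> omega
      obtain ⟨a1, a2⟩ := L u s hu.1 (fun v hv1 _ => hs v hv1) hu.2
      obtain ⟨b1, b2⟩ := H1 u (by omega)
      obtain ⟨c1, c2⟩ := ih (t - (u + 1)) (by omega) (u + 1) (by omega) rfl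
        (fun v hv => by have := hgr v (by omega); omega) ht
      refine ⟨c1.trans (b1.trans a1), ?_⟩
      rintro ⟨n, hn1, hn2, hn⟩
      by_cases hnu : n < u
      · exact c1.trans_lt (b1.trans_lt (a2 ⟨n, hn1, hnu, hn⟩))
      by_cases h1 : n = u
      · subst h1
        exact c1.trans_lt ((b2 hn).trans_le a1)
      · exact (c2 ⟨n, by omega, hn2, hn⟩).trans_le (b1.trans a1)
  have key : ∀ o : Ordinal.{0}, ∀ s, a s = o → ¬ (∀ v, s ≤ v → h s ≤ h v) := by
    intro o
    induction o using WellFoundedLT.induction with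
    | _ o ih =>
    intro s hs hfs
    obtain ⟨n, hn, hfn⟩ := hinf s
    obtain ⟨t, ht, hft⟩ := hfl (n + 1)
    exact ih (a t) (hs ▸ (F t s (by omega) hfs hft).2 ⟨n, hn, by omega, hfn⟩) t rfl hft
  obtain ⟨m, _, hm⟩ := hfl 0
  exact key _ m rfl hm


/-! ### Part 3: certificates -/

/-- Successor configurations of `(x, τ)` for a transition `t`, a set of chosen moves `Y` and
a choice of children `d`. -/
inductive Sc {Q : Type} (T : Set (List ℕ)) (t : ATrans Q) (Y : Set (SMove × Q)) (d : Q → ℕ)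
    (x : List ℕ) (τ : List (List ℕ)) : Config Q → Prop
  | drop (p : Q) (ht : t = .drop p) : Sc T t Y d x τ ⟨p, x, τ ++ [x]⟩
  | lift (p : Q) (ht : t = .lift p) : Sc T t Y d x τ ⟨p, x, τ.dropLast⟩
  | box (φ : PosBool (SMove × Q)) (p : Q) (i : ℕ) (ht : t = .form φ)
      (hY : (SMove.box, p) ∈ Y) (hi : x ++ [i] ∈ T) : Sc T t Y d x τ ⟨p, x ++ [i], τ⟩
  | dia (φ : PosBool (SMove × Q)) (p : Q) (ht : t = .form φ)
      (hY : (SMove.dia, p) ∈ Y) : Sc T t Y d x τ ⟨p, x ++ [d p], τ⟩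
  | up (φ : PosBool (SMove × Q)) (p : Q) (ht : t = .form φ)
      (hY : (SMove.up, p) ∈ Y) : Sc T t Y d x τ ⟨p, x.dropLast, τ⟩
  | stay (φ : PosBool (SMove × Q)) (p : Q) (ht : t = .form φ)
      (hY : (SMove.stay, p) ∈ Y) : Sc T t Y d x τ ⟨p, x, τ⟩
  | root (φ : PosBool (SMove × Q)) (p : Q) (ht : t = .form φ)
      (hY : (SMove.root, p) ∈ Y) : Sc T t Y d x τ ⟨p, x, τ⟩

/-- Local validity of the choice `Y, d` at configuration `c`. -/
structure LV {Q σ : Type} {k : ℕ} (A : SWPHAA Q σ k) (T : Set (List ℕ)) (V : List ℕ → σ)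
    (Y : Set (SMove × Q)) (d : Q → ℕ) (c : Config Q) : Prop where
  pos : c.pos ∈ T
  len : c.peb.length ≤ k
  drop : ∀ p, trn A V c = .drop p → c.peb.length < k
  lift : ∀ p, trn A V c = .lift p → c.peb.getLast? = some c.pos
  sat : ∀ φ, trn A V c = .form φ → PosBool.Sat (· ∈ Y) φ
  vars : ∀ φ, trn A V c = .form φ → ∀ mp ∈ Y, mp ∈ φ.vars
  dia : ∀ φ p, trn A V c = .form φ → (SMove.dia, p) ∈ Y → c.pos ++ [d p] ∈ T
  up : ∀ φ p, trn A V c = .form φ → (SMove.up, p) ∈ Y →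
    c.pos ≠ [] ∧ c.peb.getLast? ≠ some c.pos
  root : ∀ φ p, trn A V c = .form φ → (SMove.root, p) ∈ Y → c.pos = []

def Shape (β : List (List ℕ)) (x : List ℕ) (τ : List (List ℕ)) : Prop :=
  ∃ (j : ℕ) (s : List (List ℕ)), τ = β.take j ++ s ∧ s.Pairwise (· <+: ·) ∧ ∀ z ∈ s, z <+: x

theorem prefix_dropLast {z x : List ℕ} (h : z <+: x) (hne : z ≠ x) : z <+: x.dropLast := by
  rcases List.eq_nil_or_concat x with rfl | ⟨y, d, rfl⟩
  · simpa using h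
  · rw [List.concat_eq_append] at *
    rw [List.dropLast_concat]
    rcases List.prefix_concat_iff.1 h with h | h
    · exact absurd h hne
    · exact h

theorem pairwise_last {s : List (List ℕ)} (hp : s.Pairwise (· <+: ·)) {z : List ℕ} (hz : z ∈ s) :
    ∃ l, s.getLast? = some l ∧ z <+: l ∧ l ∈ s := by
  rcases List.eq_nil_or_concat s with rfl | ⟨y, d, rfl⟩
  · simp at hz
  · rw [List.concat_eq_append] at *
    refine ⟨d, by simp, ?_, by simp⟩
    rw [List.pairwise_append] at hp
    rcases List.mem_append.1 hz with h | h
    · exact hp.2.2 z h d (by simp)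
    · simp at h; subst h; exact List.prefix_refl _

theorem shape_sc {Q σ : Type} {k : ℕ} {A : SWPHAA Q σ k} {T : Set (List ℕ)} {V : List ℕ → σ}
    {Y : Set (SMove × Q)} {d : Q → ℕ} {c c' : Config Q} {β : List (List ℕ)}
    (hl : LV A T V Y d c) (hs : Shape β c.pos c.peb)
    (h : Sc T (trn A V c) Y d c.pos c.peb c') : Shape β c'.pos c'.peb := by
  obtain ⟨j, s, h1, h2, h3⟩ := hs
  cases h with
  | drop p ht =>
    refine ⟨j, s ++ [c.pos], by simp [h1], ?_, ?_⟩
    · rw [List.pairwise_append]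
      exact ⟨h2, by simp, fun a ha b hb => by simp at hb; subst hb; exact h3 a ha⟩
    · intro z hz
      rcases List.mem_append.1 hz with h | h
      · exact h3 z h
      · simp at h; subst h; exact List.prefix_refl _
  | lift p ht =>
    rcases List.eq_nil_or_concat s with rfl | ⟨y, e, rfl⟩
    · refine ⟨min (c.peb.length - 1) j, [], ?_, by simp, by simp⟩
      simp only [List.append_nil] at h1 ⊢
      conv_lhs => rw [List.dropLast_eq_take, h1, List.take_take]
      rw [← h1]
    · rw [List.concat_eq_append] at *
      refine ⟨j, y, ?_, (List.pairwise_append.1 h2).1, fun z hz => h3 z (by simp [hz])⟩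
      simp only [h1]
      rw [← List.append_assoc, List.dropLast_concat]
  | box φ p i ht hY hi => exact ⟨j, s, h1, h2, fun z hz => (h3 z hz).trans (List.prefix_append _ _)⟩
  | dia φ p ht hY => exact ⟨j, s, h1, h2, fun z hz => (h3 z hz).trans (List.prefix_append _ _)⟩
  | up φ p ht hY =>
    refine ⟨j, s, h1, h2, fun z hz => prefix_dropLast (h3 z hz) ?_⟩
    rintro rfl
    obtain ⟨l, hl1, hl2, hl3⟩ := pairwise_last h2 hz
    have : l = c.pos := (h3 l hl3).eq_of_length_le hl2.length_le
    subst this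
    refine (hl.up φ p ht hY).2 ?_
    rw [h1, List.getLast?_append, hl1]; rfl
  | stay φ p ht hY => exact ⟨j, s, h1, h2, h3⟩
  | root φ p ht hY => exact ⟨j, s, h1, h2, h3⟩

theorem sc_states {Q σ : Type} {k : ℕ} {A : SWPHAA Q σ k} {T : Set (List ℕ)} {V : List ℕ → σ}
    {Y : Set (SMove × Q)} {d : Q → ℕ} {c c' : Config Q}
    (hl : LV A T V Y d c)
    (h : Sc T (trn A V c) Y d c.pos c.peb c') : c'.st ∈ (trn A V c).states := by
  cases h with
  | drop p ht => rw [ht]; simp [ATrans.states]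
  | lift p ht => rw [ht]; simp [ATrans.states]
  | box φ p i ht hY hi => rw [ht]; exact List.mem_map.2 ⟨_, hl.vars φ ht _ hY, rfl⟩
  | dia φ p ht hY => rw [ht]; exact List.mem_map.2 ⟨_, hl.vars φ ht _ hY, rfl⟩
  | up φ p ht hY => rw [ht]; exact List.mem_map.2 ⟨_, hl.vars φ ht _ hY, rfl⟩
  | stay φ p ht hY => rw [ht]; exact List.mem_map.2 ⟨_, hl.vars φ ht _ hY, rfl⟩
  | root φ p ht hY => rw [ht]; exact List.mem_map.2 ⟨_, hl.vars φ ht _ hY, rfl⟩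

def Vac {Q σ : Type} {k : ℕ} (A : SWPHAA Q σ k) (T : Set (List ℕ)) (V : List ℕ → σ)
    (Y : Set (SMove × Q)) (d : Q → ℕ) (c : Config Q) : Prop :=
  (∀ c', ¬ Sc T (trn A V c) Y d c.pos c.peb c') ∧ ¬ TA A V c

/-- Positional certificate of acceptance. -/
structure Cert {Q σ : Type} {k : ℕ} (A : SWPHAA Q σ k) (T : Set (List ℕ)) (V : List ℕ → σ) where
  S : Set (Config Q)
  K : Set (Config Q)
  Y : Config Q → Set (SMove × Q)
  d : Config Q → Q → ℕ
  ρ : Config Q → Ordinal.{0}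
  cs : Config Q
  hKS : K ⊆ S
  hcs : cs ∈ K
  hroot : ⟨A.q0, [], []⟩ ∈ S
  lv : ∀ c ∈ S, LV A T V (Y c) (d c) c
  clos : ∀ c ∈ S, ∀ c', Sc T (trn A V c) (Y c) (d c) c.pos c.peb c' → c' ∈ S
  closK : ∀ c ∈ K, ∀ c', Sc T (trn A V c) (Y c) (d c) c.pos c.peb c' → c' ∈ K
  rk : ∀ c ∈ S, ∀ c', Sc T (trn A V c) (Y c) (d c) c.pos c.peb c' → A.idx c'.st = A.idx c.st →
    (A.cls (A.idx c.st) = .existential ∧ (c.st ∈ A.G ∨ ρ c' < ρ c)) ∨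
    (A.cls (A.idx c.st) = .universal ∧ ρ c' ≤ ρ c ∧ (c.st ∈ A.B → ρ c' < ρ c))
  low : ∀ c ∈ K, ∀ c' ∈ S, ρ c' ≤ ρ c → c' ∈ K
  shape : ∀ c ∈ S, Shape cs.peb c.pos c.peb
  core : ∃ i, (∀ c ∈ K, A.idx c.st = i) ∧
    ((A.cls i = .universal ∧ ∀ c ∈ K, c.st ∉ A.B) ∨
     (A.cls i = .existential ∧ cs.st ∈ A.G) ∨
     (∀ c ∈ K, ¬ Vac A T V (Y c) (d c) c))

theorem inf_of_chain {R : Set (List ℕ)} (hR : ∀ x : List ℕ, ∀ c : ℕ, x ++ [c] ∈ R → x ∈ R)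
    (u : ℕ → List ℕ) (hu : ∀ n, u n ∈ R)
    (hs : ∀ n, u n <+: u (n + 1) ∧ (u n).length < (u (n + 1)).length) :
    ∃ b, InfBranch R b ∧ (∀ n, b (u n).length = u n) ∧ (∀ m n, m ≤ n → b m <+: b n) := by
  have hmono : ∀ m n, m ≤ n → u m <+: u n := by
    intro m n h
    induction h with
    | refl => exact List.prefix_refl _
    | step _ ih => exact ih.trans (hs _).1
  have hlen : ∀ n, n ≤ (u n).length := by
    intro n
    induction n with
    | zero => omega
    | succ n ih => have := (hs n).2; omega
  have hpre : ∀ y x : List ℕ, x <+: y → y ∈ R → x ∈ R := by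
    intro y
    induction y using List.reverseRecOn with
    | nil => intro x hx hy; simp at hx; subst hx; exact hy
    | append_singleton y c ih =>
      intro x hx hy
      rcases List.prefix_concat_iff.1 hx with h | h
      · subst h; exact hy
      · exact ih x h (hR _ _ hy)
  have htk : ∀ m n, n ≤ (u m).length → (u n).take n = (u m).take n := by
    intro m n h
    have h1 := List.prefix_iff_eq_take.1 (show (u n).take n <+: u n from ⟨(u n).drop n, List.take_append_drop n (u n)⟩)
    rcases le_total m n with hmn | hmn
    · obtain ⟨t, ht⟩ := hmono m n hmn
      rw [← ht, List.take_append_of_le_length h]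
    · obtain ⟨t, ht⟩ := hmono n m hmn
      rw [← ht, List.take_append_of_le_length (hlen n)]
  have hmb : ∀ m n, m ≤ n → (u m).take m <+: (u n).take n := by
    intro m n h
    rw [htk n m (h.trans (hlen n))]
    exact List.take_prefix_take_left (l := u n) h
  refine ⟨fun n => (u n).take n, ⟨by simp, fun n => ⟨hpre _ _ ⟨_, List.take_append_drop _ _⟩ (hu n), ?_⟩⟩,
    fun n => ?_, hmb⟩
  · obtain ⟨t, ht⟩ := hmb n (n + 1) (Nat.le_succ n)
    have hl := congrArg List.length ht
    have h1 := hlen n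
    have h2 := hlen (n + 1)
    simp only [List.length_append, List.length_take] at hl
    have : t.length = 1 := by omega
    obtain ⟨c, rfl⟩ := List.length_eq_one_iff.1 this
    exact ⟨c, ht.symm⟩
  · simp only
    rw [htk n _ le_rfl, List.take_length]


/-! ### Part 4: from runs to certificates -/

theorem node_choice {Q σ : Type} {k : ℕ} {A : SWPHAA Q σ k} {T : Set (List ℕ)} {V : List ℕ → σ}
    {H : Config Q → Prop} {c : Config Q} (h : LocX A T V H c) :
    ∃ Y d, LV A T V Y d c ∧ ∀ c', Sc T (trn A V c) Y d c.pos c.peb c' → H c' := by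
  classical
  obtain ⟨h1, h2, h3, h4, h5⟩ := h
  cases ht : trn A V c with
  | drop p =>
    refine ⟨∅, fun _ => 0, ⟨h1, h2, ?_, ?_, ?_, ?_, ?_, ?_, ?_⟩, ?_⟩
    · exact fun p hp => (h3 p hp).1
    · exact fun p hp => (h4 p hp).1
    · intro φ hφ; rw [ht] at hφ; cases hφ
    · intro φ hφ; rw [ht] at hφ; cases hφ
    · intro φ p hφ; rw [ht] at hφ; cases hφ
    · intro φ p hφ; rw [ht] at hφ; cases hφ
    · intro φ p hφ; rw [ht] at hφ; cases hφ
    · intro c' hc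
      cases hc with
      | drop p' ht' => cases ht'; exact (h3 _ ht).2
      | lift p ht' => cases ht'
      | box φ p i ht' => cases ht'
      | dia φ p ht' => cases ht'
      | up φ p ht' => cases ht'
      | stay φ p ht' => cases ht'
      | root φ p ht' => cases ht'
  | lift p =>
    refine ⟨∅, fun _ => 0, ⟨h1, h2, ?_, ?_, ?_, ?_, ?_, ?_, ?_⟩, ?_⟩
    · exact fun p hp => (h3 p hp).1
    · exact fun p hp => (h4 p hp).1
    · intro φ hφ; rw [ht] at hφ; cases hφ
    · intro φ hφ; rw [ht] at hφ; cases hφ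
    · intro φ p hφ; rw [ht] at hφ; cases hφ
    · intro φ p hφ; rw [ht] at hφ; cases hφ
    · intro φ p hφ; rw [ht] at hφ; cases hφ
    · intro c' hc
      cases hc with
      | drop p' ht' => cases ht'
      | lift p ht' => cases ht'; exact (h4 _ ht).2
      | box φ p i ht' => cases ht'
      | dia φ p ht' => cases ht'
      | up φ p ht' => cases ht'
      | stay φ p ht' => cases ht'
      | root φ p ht' => cases ht'
  | form φ =>
    obtain ⟨Y, hY, hM⟩ := h5 φ ht
    have hd : ∀ p, ∃ i : ℕ, (SMove.dia, p) ∈ Y → c.pos ++ [i] ∈ T ∧ H ⟨p, c.pos ++ [i], c.peb⟩ := by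
      intro p
      by_cases hp : (SMove.dia, p) ∈ Y
      · obtain ⟨i, hi⟩ := hM _ hp
        exact ⟨i, fun _ => hi⟩
      · exact ⟨0, fun h => absurd h hp⟩
    choose d hd using hd
    refine ⟨{mp | mp ∈ Y ∧ mp ∈ φ.vars}, d, ⟨h1, h2, ?_, ?_, ?_, ?_, ?_, ?_, ?_⟩, ?_⟩
    · exact fun p hp => (h3 p hp).1
    · exact fun p hp => (h4 p hp).1
    · intro φ' hφ; rw [ht] at hφ; cases hφ
      exact hY.mono fun x hx h => ⟨h, hx⟩
    · intro φ' hφ; rw [ht] at hφ; cases hφ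
      exact fun mp h => h.2
    · intro φ' p hφ h
      exact (hd p h.1).1
    · intro φ' p hφ h
      have := hM _ h.1
      exact ⟨this.1, this.2.1⟩
    · intro φ' p hφ h
      exact (hM _ h.1).1
    · intro c' hc
      cases hc with
      | drop p' ht' => cases ht'
      | lift p ht' => cases ht'
      | box φ p i ht' hp hi => exact hM _ hp.1 i hi
      | dia φ p ht' hp => exact (hd p hp.1).2
      | up φ p ht' hp => exact (hM _ hp.1).2.2
      | stay φ p ht' hp => exact hM _ hp.1
      | root φ p ht' hp => exact (hM _ hp.1).2

section
variable {Q σ : Type} {k : ℕ} (A : SWPHAA Q σ k) (T : Set (List ℕ)) (V : List ℕ → σ)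
  (R : Set (List ℕ)) (ℓ : List ℕ → Config Q) (Yv : List ℕ → Set (SMove × Q))
  (dv : List ℕ → Q → ℕ)

def EE (v w : List ℕ) : Prop :=
  v ∈ R ∧ w ∈ R ∧ (∃ j, w = v ++ [j]) ∧
    Sc T (trn A V (ℓ v)) (Yv v) (dv v) (ℓ v).pos (ℓ v).peb (ℓ w)

def RelN (w v : List ℕ) : Prop :=
  A.idx (ℓ w).st = A.idx (ℓ v).st ∧
  ((A.cls (A.idx (ℓ v).st) = .existential ∧ EE A T V R ℓ Yv dv v w ∧ (ℓ v).st ∉ A.G) ∨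
   (A.cls (A.idx (ℓ v).st) = .universal ∧ ∃ u u', Relation.ReflTransGen (EE A T V R ℓ Yv dv) v u ∧
      (ℓ u).st ∈ A.B ∧ EE A T V R ℓ Yv dv u u' ∧ Relation.ReflTransGen (EE A T V R ℓ Yv dv) u' w))

variable {A T V R ℓ Yv dv}

theorem EE.pre {v w : List ℕ} (h : EE A T V R ℓ Yv dv v w) :
    v <+: w ∧ v.length < w.length := by
  obtain ⟨_, _, ⟨j, rfl⟩, _⟩ := h
  exact ⟨List.prefix_append _ _, by simp⟩

theorem EEs.pre {v w : List ℕ} (h : Relation.ReflTransGen (EE A T V R ℓ Yv dv) v w) :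
    v <+: w := by
  induction h with
  | refl => exact List.prefix_refl _
  | tail _ h ih => exact ih.trans h.pre.1

theorem EEs.mem {v w : List ℕ} (h : Relation.ReflTransGen (EE A T V R ℓ Yv dv) v w)
    (hv : v ∈ R) : w ∈ R := by
  induction h with
  | refl => exact hv
  | tail _ h ih => exact h.2.1

theorem relN_wf (hR : IsTree R) (hacc : Accepting A T V R ℓ) :
    WellFounded (RelN A T V R ℓ Yv dv) := by
  rw [wellFounded_iff_isEmpty_descending_chain]
  refine ⟨fun ⟨f, hf⟩ => ?_⟩
  have hidx : ∀ n, A.idx (ℓ (f n)).st = A.idx (ℓ (f 0)).st := by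
    intro n
    induction n with
    | zero => rfl
    | succ n ih => rw [← ih]; exact (hf n).1
  rcases (hf 0).2 with ⟨hc, _⟩ | ⟨hc, _⟩
  · have hE : ∀ n, EE A T V R ℓ Yv dv (f n) (f (n + 1)) ∧ (ℓ (f n)).st ∉ A.G := by
      intro n
      rcases (hf n).2 with ⟨_, h⟩ | ⟨h, _⟩
      · exact h
      · rw [hidx n, hc] at h; cases h
    obtain ⟨b, hb1, hb2, hb3⟩ := inf_of_chain hR.2.1 f (fun n => (hE n).1.1) (fun n => (hE n).1.pre)
    have hlen : ∀ n, (f n).length = (f 0).length + n := by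
      intro n
      induction n with
      | zero => rfl
      | succ n ih =>
        obtain ⟨j, hj⟩ := (hE n).1.2.2.1
        rw [hj, List.length_append, ih]; simp; omega
    obtain ⟨i, N, hi, h⟩ := hacc.1 b hb1
    have hbf : ∀ n, b ((f 0).length + n) = f n := fun n => by rw [← hlen, hb2]
    have hi' : i = A.idx (ℓ (f 0)).st := by
      rw [← hi ((f 0).length + N) (by omega)]
      simp only [hbf, hidx]
    subst hi'
    rcases h with ⟨_, h⟩ | ⟨h, _⟩
    · obtain ⟨n, hn, hG⟩ := h (f 0).length
      obtain ⟨m, rfl⟩ := Nat.exists_eq_add_of_le hn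
      simp only [hbf] at hG
      exact (hE m).2 hG
    · rw [hc] at h; cases h
  · have hE : ∀ n, ∃ u u', Relation.ReflTransGen (EE A T V R ℓ Yv dv) (f n) u ∧
      (ℓ u).st ∈ A.B ∧ EE A T V R ℓ Yv dv u u' ∧
        Relation.ReflTransGen (EE A T V R ℓ Yv dv) u' (f (n + 1)) := by
      intro n
      rcases (hf n).2 with ⟨h, _⟩ | ⟨_, h⟩
      · rw [hidx n, hc] at h; cases h
      · exact h
    choose u u' h1 h2 h3 h4 using hE
    have hs : ∀ n, u n <+: u (n + 1) ∧ (u n).length < (u (n + 1)).length := by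
      intro n
      have a := (h3 n).pre
      have b := (EEs.pre (h4 n)).trans (EEs.pre (h1 (n + 1)))
      exact ⟨a.1.trans b, a.2.trans_le b.length_le⟩
    have hfR : ∀ n, f (n + 1) ∈ R := fun n => EEs.mem (h4 n) (h3 n).2.1
    obtain ⟨b, hb1, hb2, hb3⟩ := inf_of_chain hR.2.1 u (fun n => (h3 n).1) hs
    have hlu : ∀ n, n ≤ (u n).length := by
      intro n
      induction n with
      | zero => omega
      | succ n ih => have := (hs n).2; omega
    have hlf : ∀ n, n ≤ (f (n + 1)).length ∧ b (f (n + 1)).length = f (n + 1) := by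
      intro n
      have e1 : u n <+: f (n + 1) := (h3 n).pre.1.trans (EEs.pre (h4 n))
      refine ⟨(hlu n).trans e1.length_le, ?_⟩
      have e2 := EEs.pre (h1 (n + 1))
      have e3 := hb3 _ _ e2.length_le
      rw [hb2] at e3
      have e4 : (b (f (n + 1)).length).length = (f (n + 1)).length := by
        have : ∀ m, (b m).length = m := by
          intro m
          induction m with
          | zero => simp [hb1.1]
          | succ m ih => obtain ⟨c, hc⟩ := (hb1.2 m).2; rw [hc]; simp [ih]
        exact this _
      exact (List.prefix_of_prefix_length_le e3 e2 e4.le).eq_of_length e4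
    obtain ⟨i, N, hi, h⟩ := hacc.1 b hb1
    have hi' : i = A.idx (ℓ (f 0)).st := by
      rw [← hi (f (N + 1)).length (hlf N).1]
      simp only [(hlf N).2, hidx]
    subst hi'
    rcases h with ⟨h, _⟩ | ⟨_, m, h⟩
    · rw [hc] at h; cases h
    · have := h _ (hlu m)
      simp only [hb2] at this
      exact this (h2 m)

theorem rank_exists (r : List ℕ → List ℕ → Prop) (hr : WellFounded r) :
    ∃ rk : List ℕ → Ordinal.{0}, (∀ w v, r w v → rk w < rk v) ∧
      (∀ w v, (∀ x, r x w → r x v) → rk w ≤ rk v) := by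
  haveI : IsWellFounded _ r := ⟨hr⟩
  refine ⟨IsWellFounded.rank r, fun w v h => IsWellFounded.rank_lt_of_rel h, fun w v h => ?_⟩
  rw [IsWellFounded.rank_eq r w]
  refine ciSup_le' fun b => ?_
  exact Order.succ_le_of_lt (IsWellFounded.rank_lt_of_rel (h _ b.2))

end


theorem EE.idx_le {Q σ : Type} {k : ℕ} {A : SWPHAA Q σ k} {T : Set (List ℕ)} {V : List ℕ → σ}
    {R : Set (List ℕ)} {ℓ : List ℕ → Config Q} {Yv : List ℕ → Set (SMove × Q)}
    {dv : List ℕ → Q → ℕ} (hhes : Hesitant A)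
    (hlv : ∀ v ∈ R, LV A T V (Yv v) (dv v) (ℓ v)) {v w : List ℕ}
    (h : Relation.ReflTransGen (EE A T V R ℓ Yv dv) v w) : A.idx (ℓ w).st ≤ A.idx (ℓ v).st := by
  induction h with
  | refl => exact le_rfl
  | tail _ h ih => exact (hhes.1 _ _ _ _ (sc_states (hlv _ h.1) h.2.2.2)).trans ih

theorem core_exists {Q σ : Type} [Finite Q] {k : ℕ} {A : SWPHAA Q σ k} {T : Set (List ℕ)}
    {V : List ℕ → σ}
    {R : Set (List ℕ)} {ℓ : List ℕ → Config Q} {Yv : List ℕ → Set (SMove × Q)}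
    {dv : List ℕ → Q → ℕ} (hhes : Hesitant A)
    (hlv : ∀ v ∈ R, LV A T V (Yv v) (dv v) (ℓ v))
    (hR : IsTree R) (hacc : Accepting A T V R ℓ) :
    ∃ w ∈ R, ∃ i, (∀ x, Relation.ReflTransGen (EE A T V R ℓ Yv dv) w x → A.idx (ℓ x).st = i) ∧
      ((A.cls i = .universal ∧ ∀ x, Relation.ReflTransGen (EE A T V R ℓ Yv dv) w x →
          (ℓ x).st ∉ A.B) ∨
       (A.cls i = .existential ∧ (ℓ w).st ∈ A.G) ∨
       (∀ x, Relation.ReflTransGen (EE A T V R ℓ Yv dv) w x →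
          ¬ Vac A T V (Yv x) (dv x) (ℓ x))) := by
  classical
  let mi : List ℕ → ℕ := fun v => sInf {n | ∃ w ∈ R, v <+: w ∧ A.idx (ℓ w).st = n}
  have hmi : ∀ v ∈ R, ∃ w ∈ R, v <+: w ∧ A.idx (ℓ w).st = mi v := by
    intro v hv
    exact Nat.sInf_mem (s := {n | ∃ w ∈ R, v <+: w ∧ A.idx (ℓ w).st = n})
      ⟨_, v, hv, List.prefix_refl _, rfl⟩
  have hmile : ∀ v, ∀ w ∈ R, v <+: w → mi v ≤ A.idx (ℓ w).st := by
    intro v w hw h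
    exact Nat.sInf_le ⟨w, hw, h, rfl⟩
  have hfin : (mi '' R).Finite := by
    refine (Set.finite_range A.idx).subset ?_
    rintro _ ⟨v, hv, rfl⟩
    obtain ⟨w, _, _, h⟩ := hmi v hv
    exact ⟨_, h⟩
  obtain ⟨_, ⟨v0, hv0, rfl⟩, hmax⟩ := Set.exists_max_image (mi '' R) id hfin ⟨_, [], hR.1, rfl⟩
  have hcls : ∀ v ∈ R, v0 <+: v → ∃ w ∈ R, v <+: w ∧ A.idx (ℓ w).st = mi v0 := by
    intro v hv hp
    obtain ⟨w, hw, h1, h2⟩ := hmi v hv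
    refine ⟨w, hw, h1, le_antisymm ?_ (hmile _ _ hw (hp.trans h1))⟩
    rw [h2]; exact hmax _ ⟨v, hv, rfl⟩
  have hpure : ∀ w ∈ R, v0 <+: w → A.idx (ℓ w).st = mi v0 →
      ∀ x, Relation.ReflTransGen (EE A T V R ℓ Yv dv) w x → A.idx (ℓ x).st = mi v0 := by
    intro w hw h1 h2 x hx
    refine le_antisymm ?_ (hmile _ _ (EEs.mem hx hw) (h1.trans (EEs.pre hx)))
    rw [← h2]; exact EE.idx_le hhes hlv hx
  by_contra hno
  have hno' : ∀ w ∈ R, v0 <+: w → A.idx (ℓ w).st = mi v0 →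
      (A.cls (mi v0) = .universal → ∃ x, Relation.ReflTransGen (EE A T V R ℓ Yv dv) w x ∧
          (ℓ x).st ∈ A.B) ∧
       (A.cls (mi v0) = .existential → (ℓ w).st ∉ A.G) ∧
       (∃ x, Relation.ReflTransGen (EE A T V R ℓ Yv dv) w x ∧
          Vac A T V (Yv x) (dv x) (ℓ x)) := by
    intro w hw h1 h2
    by_contra hc
    refine hno ⟨w, hw, mi v0, hpure w hw h1 h2, ?_⟩
    by_contra hc'
    push Not at hc'
    refine hc ⟨fun h => ?_, fun h => ?_, ?_⟩
    · exact hc'.1 h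
    · exact hc'.2.1 h
    · exact hc'.2.2
  let Good : List ℕ → Prop := fun u => u ∈ R ∧ v0 <+: u ∧ A.idx (ℓ u).st = mi v0 ∧
    (A.cls (mi v0) = .universal → (ℓ u).st ∈ A.B)
  have mkGood : ∀ v ∈ R, v0 <+: v → ∃ u, Good u ∧ v <+: u := by
    intro v hv hp
    obtain ⟨w, hw, h1, h2⟩ := hcls v hv hp
    by_cases hu : A.cls (mi v0) = .universal
    · obtain ⟨x, hx, hB⟩ := (hno' w hw (hp.trans h1) h2).1 hu
      exact ⟨x, ⟨EEs.mem hx hw, (hp.trans h1).trans (EEs.pre hx),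
        hpure w hw (hp.trans h1) h2 x hx, fun _ => hB⟩, h1.trans (EEs.pre hx)⟩
    · exact ⟨w, ⟨hw, hp.trans h1, h2, fun h => absurd h hu⟩, h1⟩
  have step : ∀ u, Good u → ∃ u', Good u' ∧ u <+: u' ∧ u.length < u'.length := by
    rintro u ⟨g1, g2, g3, g4⟩
    obtain ⟨t, ht, hvac⟩ := (hno' u g1 g2 g3).2.2
    have htR := EEs.mem ht g1
    have : ∃ j, t ++ [j] ∈ R := by
      by_contra hj
      push Not at hj
      exact hvac.2 ((trueApplies_iff A V ℓ t).1 (hacc.2 t htR hj))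
    obtain ⟨j, hj⟩ := this
    have hp := (EEs.pre ht).trans (List.prefix_append t [j])
    obtain ⟨u', hu', hpu⟩ := mkGood _ hj (g2.trans hp)
    refine ⟨u', hu', hp.trans hpu, ?_⟩
    have := hpu.length_le
    have := (EEs.pre ht).length_le
    simp at *
    omega
  obtain ⟨u0, hu0, -⟩ := mkGood v0 hv0 (List.prefix_refl _)
  let F : ℕ → {u // Good u} := fun n => Nat.rec ⟨u0, hu0⟩
    (fun _ u => ⟨(step u.1 u.2).choose, (step u.1 u.2).choose_spec.1⟩) n
  have hF : ∀ n, (F n).1 <+: (F (n + 1)).1 ∧ (F n).1.length < (F (n + 1)).1.length := fun n =>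
    (step (F n).1 (F n).2).choose_spec.2
  have hlu : ∀ n, n ≤ (F n).1.length := by
    intro n
    induction n with
    | zero => omega
    | succ n ih => have := (hF n).2; omega
  obtain ⟨b, hb1, hb2, hb3⟩ := inf_of_chain hR.2.1 (fun n => (F n).1) (fun n => (F n).2.1) hF
  obtain ⟨i, N, hi, h⟩ := hacc.1 b hb1
  have hi' : i = mi v0 := by
    rw [← hi _ (hlu N)]
    have := hb2 N
    simp only [this]
    exact (F N).2.2.2.1
  subst hi'
  rcases h with ⟨hc, h⟩ | ⟨hc, m, h⟩
  · obtain ⟨n, hn, hG⟩ := h (max N (F 0).1.length)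
    have h1 : v0 <+: b n := by
      refine (F 0).2.2.1.trans ?_
      have := hb3 (F 0).1.length n ((le_max_right _ _).trans hn)
      rwa [hb2 0] at this
    exact (hno' (b n) (hb1.2 n).1 h1 (hi n ((le_max_left _ _).trans hn))).2.1 hc hG
  · have h1 := h _ (hlu m)
    have := hb2 m
    simp only [this] at h1
    exact h1 ((F m).2.2.2.2 hc)

theorem cert_of_accepts {Q σ : Type} [Finite Q] {k : ℕ} {A : SWPHAA Q σ k} {T : Set (List ℕ)}
    {V : List ℕ → σ} (hhes : Hesitant A) (h : SAccepts A T V) : Nonempty (Cert A T V) := by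
  classical
  obtain ⟨R, ℓ, ⟨hR, hℓ0, hloc⟩, hacc⟩ := h
  have hch : ∀ v, ∃ (Y : Set (SMove × Q)) (d : Q → ℕ), v ∈ R → LV A T V Y d (ℓ v) ∧
      ∀ c', Sc T (trn A V (ℓ v)) Y d (ℓ v).pos (ℓ v).peb c' → HasChild R ℓ v c' := by
    intro v
    by_cases hv : v ∈ R
    · obtain ⟨Y, d, h⟩ := node_choice ((localOK_iff A T V R ℓ v).1 (hloc v hv))
      exact ⟨Y, d, fun _ => h⟩
    · exact ⟨∅, fun _ => 0, fun h => absurd h hv⟩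
  choose Yv dv hYd using hch
  have hlv : ∀ v ∈ R, LV A T V (Yv v) (dv v) (ℓ v) := fun v hv => (hYd v hv).1
  let E := EE A T V R ℓ Yv dv
  have hchild : ∀ v ∈ R, ∀ c', Sc T (trn A V (ℓ v)) (Yv v) (dv v) (ℓ v).pos (ℓ v).peb c' →
      ∃ w, E v w ∧ ℓ w = c' := by
    intro v hv c' hc
    obtain ⟨j, hj1, hj2⟩ := (hYd v hv).2 c' hc
    exact ⟨v ++ [j], ⟨hv, hj1, ⟨j, rfl⟩, hj2 ▸ hc⟩, hj2⟩
  obtain ⟨ws, hws, i, hi, hcore⟩ := core_exists hhes hlv hR hacc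
  obtain ⟨rk, hrk1, hrk2⟩ := rank_exists (RelN A T V R ℓ Yv dv) (relN_wf hR hacc)
  have hnode : ∀ v w, E v w → A.idx (ℓ w).st = A.idx (ℓ v).st →
      (A.cls (A.idx (ℓ v).st) = .existential ∧ ((ℓ v).st ∈ A.G ∨ rk w < rk v)) ∨
      (A.cls (A.idx (ℓ v).st) = .universal ∧ rk w ≤ rk v ∧ ((ℓ v).st ∈ A.B → rk w < rk v)) := by
    intro v w hvw hidx
    cases hc : A.cls (A.idx (ℓ v).st) with
    | existential =>
      refine Or.inl ⟨rfl, ?_⟩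
      by_cases hG : (ℓ v).st ∈ A.G
      · exact Or.inl hG
      · exact Or.inr (hrk1 _ _ ⟨hidx, Or.inl ⟨hc, hvw, hG⟩⟩)
    | universal =>
      refine Or.inr ⟨rfl, hrk2 _ _ ?_, fun hB => hrk1 _ _ ⟨hidx, Or.inr ⟨hc, v, w, .refl, hB, hvw, .refl⟩⟩⟩
      rintro x ⟨h1, h2⟩
      refine ⟨h1.trans hidx, Or.inr ⟨hc, ?_⟩⟩
      rw [hidx, hc] at h2
      rcases h2 with ⟨h2, _⟩ | ⟨_, u, u', h3, h4⟩
      · cases h2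
      · exact ⟨u, u', h3.head hvw, h4⟩
    | transient =>
      exact absurd hidx (hhes.2.1 _ _ _ hc _ (sc_states (hlv _ hvw.1) hvw.2.2.2))
  let PK : Set (List ℕ) := {w | Relation.ReflTransGen E ws w}
  let P0 : Set (List ℕ) := {w | Relation.ReflTransGen E [] w}
  let K : Set (Config Q) := ℓ '' PK
  let S : Set (Config Q) := ℓ '' P0 ∪ K
  have hPKR : ∀ w ∈ PK, w ∈ R := fun w hw => EEs.mem hw hws
  have hP0R : ∀ w ∈ P0, w ∈ R := fun w hw => EEs.mem hw hR.1
  have hmin : ∀ (P : Set (List ℕ)) (c : Config Q), ∃ v, c ∈ ℓ '' P → v ∈ P ∧ ℓ v = c ∧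
      ∀ w ∈ P, ℓ w = c → rk v ≤ rk w := by
    intro P c
    by_cases hc : c ∈ ℓ '' P
    · obtain ⟨v0, hv0, hv0'⟩ := hc
      obtain ⟨v, hv, hmn⟩ := (InvImage.wf rk Ordinal.lt_wf).has_min {v | v ∈ P ∧ ℓ v = c}
        ⟨v0, hv0, hv0'⟩
      exact ⟨v, fun _ => ⟨hv.1, hv.2, fun w hw hw' => not_lt.1 (hmn w ⟨hw, hw'⟩)⟩⟩
    · exact ⟨[], fun h => absurd h hc⟩
  choose nd hnd using hmin
  let node : Config Q → List ℕ := fun c => if c ∈ K then nd PK c else nd P0 c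
  let Ω : Ordinal.{0} := Order.succ (⨆ v : List ℕ, rk v)
  have hΩ : ∀ v, rk v < Ω := fun v =>
    Order.lt_succ_of_le (le_ciSup Ordinal.bddAbove_of_small v)
  let ρ : Config Q → Ordinal.{0} := fun c =>
    if c ∈ K then rk (nd PK c) else Ω + rk (nd P0 c)
  have nodeK : ∀ c ∈ K, node c = nd PK c := fun c hc => if_pos hc
  have nodeS : ∀ c ∈ S, node c ∈ R ∧ ℓ (node c) = c ∧ (c ∉ K → node c ∈ P0) ∧
      (c ∈ K → node c ∈ PK) := by
    intro c hc
    by_cases hK : c ∈ K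
    · rw [nodeK c hK]
      obtain ⟨h1, h2, h3⟩ := hnd PK c hK
      exact ⟨hPKR _ h1, h2, fun h => absurd hK h, fun _ => h1⟩
    · have hc0 : c ∈ ℓ '' P0 := hc.resolve_right hK
      have : node c = nd P0 c := if_neg hK
      rw [this]
      obtain ⟨h1, h2, h3⟩ := hnd P0 c hc0
      exact ⟨hP0R _ h1, h2, fun _ => h1, fun h => absurd h hK⟩
  have key : ∀ c ∈ S, ∀ c', Sc T (trn A V c) (Yv (node c)) (dv (node c)) c.pos c.peb c' →
      ∃ w, E (node c) w ∧ ℓ w = c' ∧ (c ∈ K → w ∈ PK) ∧ (c ∉ K → w ∈ P0) := by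
    intro c hc c' hs
    obtain ⟨h1, h2, h3, h4⟩ := nodeS c hc
    obtain ⟨w, hw, hw'⟩ := hchild (node c) h1 c' (by rw [h2]; exact hs)
    exact ⟨w, hw, hw', fun h => Relation.ReflTransGen.tail (h4 h) hw,
      fun h => Relation.ReflTransGen.tail (h3 h) hw⟩
  refine ⟨⟨S, K, fun c => Yv (node c), fun c => dv (node c), ρ, ℓ ws, ?_, ?_, ?_, ?_, ?_, ?_, ?_,
    ?_, ?_, ?_⟩⟩
  · exact Set.subset_union_right
  · exact ⟨ws, .refl, rfl⟩
  · exact Or.inl ⟨[], .refl, hℓ0⟩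
  · intro c hc
    obtain ⟨h1, h2, _⟩ := nodeS c hc
    have := hlv _ h1
    rwa [h2] at this
  · intro c hc c' hs
    obtain ⟨w, _, h2, h3, h4⟩ := key c hc c' hs
    by_cases hK : c ∈ K
    · exact Or.inr ⟨w, h3 hK, h2⟩
    · exact Or.inl ⟨w, h4 hK, h2⟩
  · intro c hc c' hs
    obtain ⟨w, _, h2, h3, h4⟩ := key c (Or.inr hc) c' hs
    exact ⟨w, h3 hc, h2⟩
  · intro c hc c' hs hidx
    obtain ⟨w, h1, h2, h3, h4⟩ := key c hc c' hs
    have hn := hnode _ _ h1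
    have hnc := (nodeS c hc).2.1
    rw [hnc, h2] at hn
    have hn := hn hidx
    by_cases hK : c ∈ K
    · have hc' : c' ∈ K := ⟨w, h3 hK, h2⟩
      have e1 : ρ c = rk (node c) := by simp only [ρ, node, if_pos hK]
      have e2 : ρ c' ≤ rk w := by
        simp only [ρ, if_pos hc']
        exact (hnd PK c' hc').2.2 w (h3 hK) h2
      rw [e1]
      refine hn.imp (fun h => ⟨h.1, h.2.imp_right fun h => e2.trans_lt h⟩)
        fun h => ⟨h.1, e2.trans h.2.1, fun hB => e2.trans_lt (h.2.2 hB)⟩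
    · have e1 : ρ c = Ω + rk (node c) := by simp only [ρ, node, if_neg hK]
      have e2 : ρ c' ≤ Ω + rk w := by
        by_cases hc' : c' ∈ K
        · simp only [ρ, if_pos hc']
          exact (hΩ _).le.trans le_self_add
        · simp only [ρ, if_neg hc']
          exact add_le_add_right ((hnd P0 c' ⟨w, h4 hK, h2⟩).2.2 w (h4 hK) h2) _
      rw [e1]
      refine hn.imp (fun h => ⟨h.1, h.2.imp_right fun h => e2.trans_lt ?_⟩)
        fun h => ⟨h.1, e2.trans ?_, fun hB => e2.trans_lt ?_⟩
      · exact add_le_add_right h.2.1 _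
      · exact add_lt_add_right (h.2.2 hB) _
      · exact add_lt_add_right h _
  · intro c hc c' hc' hle
    by_contra hK
    simp only [ρ, if_pos hc, if_neg hK] at hle
    exact absurd (le_self_add.trans hle) (not_le.2 (hΩ _))
  · have hsh : ∀ v0 v, Relation.ReflTransGen E v0 v → Shape (ℓ ws).peb (ℓ v0).pos (ℓ v0).peb →
        Shape (ℓ ws).peb (ℓ v).pos (ℓ v).peb := by
      intro v0 v h h0
      induction h with
      | refl => exact h0
      | tail _ h ih => exact shape_sc (hlv _ h.1) ih h.2.2.2
    rintro c (⟨v, hv, rfl⟩ | ⟨v, hv, rfl⟩)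
    · refine hsh _ _ hv ⟨0, [], ?_, by simp, by simp⟩
      simp [hℓ0]
    · refine hsh _ _ hv ⟨(ℓ ws).peb.length, [], ?_, by simp, by simp⟩
      simp
  · refine ⟨i, ?_, ?_⟩
    · rintro c ⟨v, hv, rfl⟩
      exact hi v hv
    · rcases hcore with ⟨h1, h2⟩ | h | h
      · refine Or.inl ⟨h1, ?_⟩
        rintro c ⟨v, hv, rfl⟩
        exact h2 v hv
      · exact Or.inr (Or.inl h)
      · refine Or.inr (Or.inr ?_)
        intro c hc
        obtain ⟨h1, h2, h3, h4⟩ := nodeS c (Or.inr hc)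
        have := h _ (h4 hc)
        rwa [h2] at this


/-! ### Part 5: the run on the reduced tree -/

/-- Departure configuration, real pebble stack and entry configuration of an excursion. -/
structure Frame (Q : Type) where
  c : Config Q
  rp : List (List ℕ)
  e : Config Q

structure XS (Q : Type) where
  cur : Config Q
  rp : List (List ℕ)
  fr : List (Frame Q)

instance frameCountable {Q : Type} [Countable Q] : Countable (Frame Q) := by
  have : Function.Injective (fun c : Frame Q => (c.c, c.rp, c.e)) := by
    rintro ⟨a, b, c⟩ ⟨a', b', c'⟩ h
    simpa using h
  exact this.countable

instance xsCountable {Q : Type} [Countable Q] : Countable (XS Q) := by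
  have : Function.Injective (fun c : XS Q => (c.cur, c.rp, c.fr)) := by
    rintro ⟨a, b, c⟩ ⟨a', b', c'⟩ h
    simpa using h
  exact this.countable

section
variable {Q σ : Type} {k : ℕ} {A : SWPHAA Q σ k} {T : Set (List ℕ)} {V : List ℕ → σ}

def CSc (C : Cert A T V) (c c' : Config Q) : Prop :=
  Sc T (trn A V c) (C.Y c) (C.d c) c.pos c.peb c'

def CVac (C : Cert A T V) (c : Config Q) : Prop := Vac A T V (C.Y c) (C.d c) c

def ValEq (C : Cert A T V) (q : Q) (x : List ℕ) (τ τ' : List (List ℕ)) : Prop :=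
  ∀ q', q' ≠ q → ((⟨q', x, τ⟩ : Config Q) ∈ C.S ↔ (⟨q', x, τ'⟩ : Config Q) ∈ C.S) ∧
    ((⟨q', x, τ⟩ : Config Q) ∈ C.S →
      ((⟨q', x, τ⟩ : Config Q) ∈ C.K ↔ (⟨q', x, τ'⟩ : Config Q) ∈ C.K) ∧
      cmp (C.ρ ⟨q', x, τ⟩) (C.ρ ⟨q, x, τ⟩) = cmp (C.ρ ⟨q', x, τ'⟩) (C.ρ ⟨q, x, τ'⟩))

def Exact (C : Cert A T V) (c : Config Q) : Prop := c.peb = C.cs.peb.take c.peb.length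

structure RepC (C : Cert A T V) (T' : Set (List ℕ)) (c : Config Q) (p : Q) (r : Config Q) :
    Prop where
  mem : r ∈ C.S
  st : r.st = c.st
  pos : r.pos = c.pos
  len : r.peb.length = c.peb.length
  form : ∃ φ, trn A V r = .form φ
  dia : (SMove.dia, p) ∈ C.Y r
  kid : c.pos ++ [C.d r p] ∈ T'
  top : ∀ l, r.peb.getLast? = some l → l <+: c.pos
  rank : C.ρ ⟨p, c.pos ++ [C.d r p], r.peb⟩ ≤ C.ρ ⟨p, c.pos ++ [C.d c p], c.peb⟩
  val : ValEq C c.st c.pos r.peb c.peb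

/-- The properties of the reduced tree that are needed for the construction. -/
structure Red (C : Cert A T V) (T' : Set (List ℕ)) : Prop where
  sub : T' ⊆ T
  nil : [] ∈ T'
  pre : ∀ x : List ℕ, ∀ i : ℕ, x ++ [i] ∈ T' → x ∈ T'
  cs : C.cs.pos ∈ T'
  kid : ∀ x : List ℕ, ∀ i : ℕ, x ∈ T' → x ++ [i] ∈ T → ∃ i', x ++ [i'] ∈ T'
  exa : ∀ c ∈ C.S, c.pos ∈ T' → Exact C c → ∀ φ p, trn A V c = .form φ →
    (SMove.dia, p) ∈ C.Y c → c.pos ++ [C.d c p] ∈ T'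
  gen : ∀ c ∈ C.S, c.pos ∈ T' → ¬ Exact C c → ∀ φ p, trn A V c = .form φ →
    (SMove.dia, p) ∈ C.Y c → ∃ r, RepC C T' c p r

def FrameOK (C : Cert A T V) (F : Frame Q) : Prop :=
  (∃ i, F.e.pos = F.c.pos ++ [i]) ∧ F.e.peb.length = F.c.peb.length ∧
  (∀ l, F.e.peb.getLast? = some l → ¬ F.e.pos <+: l) ∧
  (∀ l, F.rp.getLast? = some l → ¬ F.e.pos <+: l) ∧
  (⟨F.c.st, F.c.pos, F.e.peb⟩ : Config Q) ∈ C.S ∧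
  CSc C ⟨F.c.st, F.c.pos, F.e.peb⟩ F.e ∧
  ValEq C F.c.st F.c.pos F.e.peb F.c.peb

def SInv (C : Cert A T V) (T' : Set (List ℕ)) :
    List (Frame Q) → Config Q → List (List ℕ) → Prop
  | [], c, rp => c ∈ C.S ∧ c.pos ∈ T' ∧ rp = c.peb
  | F :: fr, c, rp => c ∈ C.S ∧ c.pos ∈ T' ∧ F.e.pos <+: c.pos ∧
      (∃ s, c.peb = F.e.peb ++ s ∧ rp = F.rp ++ s ∧ s.Pairwise (· <+: ·) ∧
        ∀ z ∈ s, F.e.pos <+: z ∧ z <+: c.pos) ∧ FrameOK C F ∧ SInv C T' fr F.c F.rp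

inductive Mv (C : Cert A T V) (T' : Set (List ℕ)) : XS Q → XS Q → Prop
  | step (c c' : Config Q) (rp rp' : List (List ℕ)) (fr : List (Frame Q)) (hs : CSc C c c')
      (hT : c'.pos ∈ T') (hf : ∀ F ∈ fr.head?, F.e.pos <+: c'.pos)
      (h1 : ∀ p, trn A V c = .drop p → rp' = rp ++ [c.pos])
      (h2 : ∀ p, trn A V c = .lift p → rp' = rp.dropLast)
      (h3 : ∀ φ, trn A V c = .form φ → rp' = rp) : Mv C T' ⟨c, rp, fr⟩ ⟨c', rp', fr⟩
  | push (c : Config Q) (rp : List (List ℕ)) (fr : List (Frame Q)) (φ : PosBool (SMove × Q))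
      (p : Q) (r : Config Q) (hφ : trn A V c = .form φ) (hY : (SMove.dia, p) ∈ C.Y c)
      (hx : ¬ Exact C c) (hr : RepC C T' c p r) :
      Mv C T' ⟨c, rp, fr⟩ ⟨⟨p, c.pos ++ [C.d r p], r.peb⟩, rp,
        ⟨c, rp, ⟨p, c.pos ++ [C.d r p], r.peb⟩⟩ :: fr⟩
  | pop (c : Config Q) (rp : List (List ℕ)) (F : Frame Q) (fr : List (Frame Q))
      (φ : PosBool (SMove × Q)) (p : Q) (hφ : trn A V c = .form φ) (hY : (SMove.up, p) ∈ C.Y c)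
      (hp : c.pos = F.e.pos) :
      Mv C T' ⟨c, rp, F :: fr⟩ ⟨⟨p, F.c.pos, F.c.peb⟩, F.rp, fr⟩

def XInv (C : Cert A T V) (T' : Set (List ℕ)) (a : XS Q) : Prop := SInv C T' a.fr a.cur a.rp

variable {C : Cert A T V} {T' : Set (List ℕ)}

theorem SInv.memS {fr : List (Frame Q)} {c : Config Q} {rp : List (List ℕ)}
    (h : SInv C T' fr c rp) : c ∈ C.S := by
  cases fr <;> exact h.1

theorem SInv.memT {fr : List (Frame Q)} {c : Config Q} {rp : List (List ℕ)}
    (h : SInv C T' fr c rp) : c.pos ∈ T' := by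
  cases fr <;> exact h.2.1

theorem SInv.len {fr : List (Frame Q)} {c : Config Q} {rp : List (List ℕ)}
    (h : SInv C T' fr c rp) : rp.length = c.peb.length := by
  induction fr generalizing c rp with
  | nil => rw [h.2.2]
  | cons F fr ih =>
    obtain ⟨_, _, _, ⟨s, h1, h2, _⟩, h3, h4⟩ := h
    rw [h1, h2, List.length_append, List.length_append, ih h4, h3.2.1]

theorem SInv.vis {fr : List (Frame Q)} {c : Config Q} {rp : List (List ℕ)}
    (h : SInv C T' fr c rp) : rp.getLast? = some c.pos ↔ c.peb.getLast? = some c.pos := by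
  cases fr with
  | nil => rw [h.2.2]
  | cons F fr =>
    obtain ⟨_, _, hp, ⟨s, h1, h2, _⟩, h3, h4⟩ := h
    rcases List.eq_nil_or_concat s with rfl | ⟨y, d, rfl⟩
    · simp only [List.append_nil] at h1 h2
      rw [h1, h2]
      exact ⟨fun h => absurd hp (h3.2.2.2.1 _ h), fun h => absurd hp (h3.2.2.1 _ h)⟩
    · rw [List.concat_eq_append] at *
      rw [h1, h2, ← List.append_assoc, ← List.append_assoc]
      simp

theorem SInv.trn_eq {fr : List (Frame Q)} {c : Config Q} {rp : List (List ℕ)}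
    (h : SInv C T' fr c rp) : trn A V ⟨c.st, c.pos, rp⟩ = trn A V c := by
  unfold trn
  simp only [h.vis]

/-- Changing the state. -/
theorem SInv.change {fr : List (Frame Q)} {c c' : Config Q} {rp : List (List ℕ)}
    (h : SInv C T' fr c rp) (h1 : c'.pos = c.pos) (h2 : c'.peb = c.peb) (h3 : c' ∈ C.S) :
    SInv C T' fr c' rp := by
  cases fr with
  | nil => exact ⟨h3, h1 ▸ h.2.1, h2 ▸ h.2.2⟩
  | cons F fr =>
    unfold SInv at h ⊢
    rw [h1, h2]
    exact ⟨h3, h.2⟩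

theorem nonexact_top {c : Config Q} (hc : c ∈ C.S) (hx : ¬ Exact C c) :
    ∃ l, c.peb.getLast? = some l ∧ l <+: c.pos := by
  obtain ⟨j, s, h1, h2, h3⟩ := C.shape c hc
  rcases List.eq_nil_or_concat s with rfl | ⟨y, d, rfl⟩
  · exfalso
    apply hx
    unfold Exact
    rw [List.append_nil] at h1
    conv_rhs => rw [h1]
    rw [List.length_take]
    rw [h1]
    rcases le_total j C.cs.peb.length with h | h
    · rw [min_eq_left h]
    · rw [min_eq_right h, List.take_of_length_le h, List.take_of_length_le le_rfl]
  · rw [List.concat_eq_append] at *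
    refine ⟨d, ?_, h3 d (by simp)⟩
    rw [h1, ← List.append_assoc]; simp

theorem SInv.top {fr : List (Frame Q)} {c : Config Q} {rp : List (List ℕ)}
    (h : SInv C T' fr c rp) (hx : ¬ Exact C c) (l : List ℕ) (hl : rp.getLast? = some l) (i : ℕ) :
    ¬ (c.pos ++ [i]) <+: l := by
  intro hpre
  have hno : ∀ l, l <+: c.pos → ¬ (c.pos ++ [i]) <+: l := by
    intro l h1 h2
    have := (h2.trans h1).length_le
    simp at this
  obtain ⟨l', h1, h2⟩ := nonexact_top h.memS hx
  cases fr with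
  | nil =>
    rw [h.2.2, h1] at hl
    cases hl
    exact hno _ h2 hpre
  | cons F fr =>
    obtain ⟨_, _, hp, ⟨s, e1, e2, e3, e4⟩, h3, h4⟩ := h
    rcases List.eq_nil_or_concat s with rfl | ⟨y, d, rfl⟩
    · simp only [List.append_nil] at e1 e2
      rw [e2] at hl
      exact h3.2.2.2.1 _ hl ((hp.trans (List.prefix_append _ _)).trans hpre)
    · rw [List.concat_eq_append] at *
      rw [e2, ← List.append_assoc] at hl
      simp at hl
      subst hl
      exact hno _ (e4 d (by simp)).2 hpre

theorem Mv.inv {a b : XS Q} (hm : Mv C T' a b) (ha : XInv C T' a) : XInv C T' b := by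
  cases hm with
  | step c c' rp rp' fr hs hT hf h1 h2 h3 =>
    unfold XInv at *
    simp only at *
    have hS : c' ∈ C.S := C.clos c ha.memS c' hs
    have hlv := C.lv c ha.memS
    cases fr with
    | nil =>
      refine ⟨hS, hT, ?_⟩
      have e := ha.2.2
      cases hs with
      | drop p ht => simp only [h1 p ht, e]
      | lift p ht => simp only [h2 p ht, e]
      | box φ p i ht hY hi => simp only [h3 φ ht, e]
      | dia φ p ht hY => simp only [h3 φ ht, e]
      | up φ p ht hY => simp only [h3 φ ht, e]
      | stay φ p ht hY => simp only [h3 φ ht, e]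
      | root φ p ht hY => simp only [h3 φ ht, e]
    | cons F fr =>
      have hFp := hf F (by simp)
      obtain ⟨_, _, hp, ⟨s, e1, e2, e3, e4⟩, h4, h5⟩ := ha
      refine ⟨hS, hT, hFp, ?_, h4, h5⟩
      have hsx : c.peb.getLast? ≠ some c.pos → c.pos ∉ s := by
        intro hne hmem
        obtain ⟨l, hl1, hl2, hl3⟩ := pairwise_last e3 hmem
        have : l = c.pos := (e4 l hl3).2.eq_of_length_le hl2.length_le
        subst this
        apply hne
        rw [e1, List.getLast?_append, hl1]; rfl
      cases hs with
      | drop p ht =>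
        refine ⟨s ++ [c.pos], by simp [e1], by simp [h1 p ht, e2], ?_, ?_⟩
        · rw [List.pairwise_append]
          exact ⟨e3, by simp, fun a ha b hb => by simp at hb; subst hb; exact (e4 a ha).2⟩
        · intro z hz
          rcases List.mem_append.1 hz with h | h
          · exact e4 z h
          · simp at h; subst h; exact ⟨hp, List.prefix_refl _⟩
      | lift p ht =>
        rcases List.eq_nil_or_concat s with rfl | ⟨y, e, rfl⟩
        · exfalso
          have := hlv.lift p ht
          rw [e1, List.append_nil] at this
          exact h4.2.2.1 _ this hp
        · rw [List.concat_eq_append] at *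
          refine ⟨y, ?_, ?_, (List.pairwise_append.1 e3).1, fun z hz => e4 z (by simp [hz])⟩
          · simp only [e1]
            rw [← List.append_assoc, List.dropLast_concat]
          · rw [h2 p ht, e2]
            rw [← List.append_assoc, List.dropLast_concat]
      | box φ p i ht hY hi =>
        exact ⟨s, e1, by rw [h3 φ ht, e2], e3,
          fun z hz => ⟨(e4 z hz).1, (e4 z hz).2.trans (List.prefix_append _ _)⟩⟩
      | dia φ p ht hY =>
        exact ⟨s, e1, by rw [h3 φ ht, e2], e3,
          fun z hz => ⟨(e4 z hz).1, (e4 z hz).2.trans (List.prefix_append _ _)⟩⟩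
      | up φ p ht hY =>
        refine ⟨s, e1, by rw [h3 φ ht, e2], e3, fun z hz => ⟨(e4 z hz).1, ?_⟩⟩
        refine prefix_dropLast (e4 z hz).2 ?_
        rintro rfl
        exact hsx (hlv.up φ p ht hY).2 hz
      | stay φ p ht hY => exact ⟨s, e1, by rw [h3 φ ht, e2], e3, e4⟩
      | root φ p ht hY => exact ⟨s, e1, by rw [h3 φ ht, e2], e3, e4⟩
  | push c rp fr φ p r hφ hY hx hr =>
    unfold XInv at *
    simp only at *
    obtain ⟨φ', hφ'⟩ := hr.form
    have hreq : (⟨c.st, c.pos, r.peb⟩ : Config Q) = r := by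
      rw [← hr.st, ← hr.pos]
    have hsc : CSc C r ⟨p, c.pos ++ [C.d r p], r.peb⟩ := by
      have := Sc.dia (T := T) (d := C.d r) (x := r.pos) (τ := r.peb) φ' p hφ' hr.dia
      rw [hr.pos] at this
      unfold CSc
      rw [hr.pos]
      exact this
    refine ⟨C.clos r hr.mem _ hsc, hr.kid, List.prefix_refl _, ⟨[], by simp, by simp, by simp, by simp⟩,
      ⟨⟨_, rfl⟩, hr.len, ?_, ?_, ?_, ?_, hr.val⟩, ha⟩
    · intro l hl hpre
      have := (hpre.trans (hr.top l hl)).length_le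
      simp at this
    · intro l hl
      exact ha.top hx l hl _
    · simp only [hreq]; exact hr.mem
    · simp only [hreq]; exact hsc
  | pop c rp F fr φ p hφ hY hp =>
    unfold XInv at *
    simp only at *
    obtain ⟨hcS, hcT, hpp, ⟨s, e1, e2, e3, e4⟩, h4, h5⟩ := ha
    have hlv := C.lv c hcS
    have hs : s = [] := by
      by_contra hne
      obtain ⟨y, e, rfl⟩ := (List.eq_nil_or_concat s).resolve_left hne
      rw [List.concat_eq_append] at *
      have h1 := e4 e (by simp)
      rw [← hp] at h1
      have : e = c.pos := h1.2.eq_of_length_le h1.1.length_le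
      apply (hlv.up φ p hφ hY).2
      rw [e1, ← List.append_assoc]; simp [this]
    subst hs
    rw [List.append_nil] at e1 e2
    have hw : (⟨p, F.c.pos, F.e.peb⟩ : Config Q) ∈ C.S := by
      have := C.clos c hcS _ (Sc.up φ p hφ hY)
      obtain ⟨i, hi⟩ := h4.1
      rw [hp, hi, List.dropLast_concat, e1] at this
      exact this
    refine h5.change rfl rfl ?_
    by_cases hpq : p = F.c.st
    · subst hpq; exact h5.memS
    · exact ((h4.2.2.2.2.2.2 p hpq).1).1 hw

/-- Facts about a pop move. -/
theorem pop_facts {c : Config Q} {rp : List (List ℕ)} {F : Frame Q} {fr : List (Frame Q)}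
    {φ : PosBool (SMove × Q)} {p : Q} (hφ : trn A V c = .form φ) (hY : (SMove.up, p) ∈ C.Y c)
    (hp : c.pos = F.e.pos) (ha : SInv C T' (F :: fr) c rp) :
    CSc C c ⟨p, F.c.pos, F.e.peb⟩ ∧ rp = F.rp ∧ c.pos.dropLast = F.c.pos := by
  obtain ⟨hcS, hcT, hpp, ⟨s, e1, e2, e3, e4⟩, h4, h5⟩ := ha
  have hlv := C.lv c hcS
  have hs : s = [] := by
    by_contra hne
    obtain ⟨y, e, rfl⟩ := (List.eq_nil_or_concat s).resolve_left hne
    rw [List.concat_eq_append] at *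
    have h1 := e4 e (by simp)
    rw [← hp] at h1
    have : e = c.pos := h1.2.eq_of_length_le h1.1.length_le
    apply (hlv.up φ p hφ hY).2
    rw [e1, ← List.append_assoc]; simp [this]
  subst hs
  rw [List.append_nil] at e1 e2
  obtain ⟨i, hi⟩ := h4.1
  have hd : c.pos.dropLast = F.c.pos := by rw [hp, hi, List.dropLast_concat]
  refine ⟨?_, e2, hd⟩
  have : CSc C c _ := Sc.up φ p hφ hY
  rw [hd, e1] at this
  exact this

end


theorem cmp_eq_cmp_iff_lt {a b c d : Ordinal.{0}} (h : cmp a b = cmp c d) : a < b ↔ c < d := by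
  rw [← cmp_eq_lt_iff, ← cmp_eq_lt_iff, h]

theorem cmp_eq_cmp_iff_le {a b c d : Ordinal.{0}} (h : cmp a b = cmp c d) : a ≤ b ↔ c ≤ d := by
  rw [← not_lt, ← not_lt, ← cmp_eq_gt_iff, ← cmp_eq_gt_iff, h]

section
variable {Q σ : Type} {k : ℕ} {A : SWPHAA Q σ k} {T : Set (List ℕ)} {V : List ℕ → σ}

def Nx (C : Cert A T V) (T' : Set (List ℕ)) (a b : XS Q) : Prop :=
  Mv C T' a b ∨ (CVac C a.cur ∧ b = ⟨C.cs, C.cs.peb, []⟩)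

def xcfg (a : XS Q) : Config Q := ⟨a.cur.st, a.cur.pos, a.rp⟩

variable {C : Cert A T V} {T' : Set (List ℕ)}

theorem SInv.head {fr : List (Frame Q)} {c : Config Q} {rp : List (List ℕ)}
    (h : SInv C T' fr c rp) : ∀ F ∈ fr.head?, F.e.pos <+: c.pos := by
  cases fr with
  | nil => simp
  | cons F fr =>
    intro F' hF'
    simp at hF'
    subst hF'
    exact h.2.2.1

theorem Nx.inv (hT' : Red C T') {a b : XS Q} (h : Nx C T' a b) (ha : XInv C T' a) :
    XInv C T' b := by
  rcases h with h | ⟨_, rfl⟩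
  · exact h.inv ha
  · exact ⟨C.hKS C.hcs, hT'.cs, rfl⟩

theorem form_step {a : XS Q} {φ : PosBool (SMove × Q)} (hφ : trn A V a.cur = .form φ)
    {c' : Config Q} (hs : CSc C a.cur c') (hT : c'.pos ∈ T')
    (hf : ∀ F ∈ a.fr.head?, F.e.pos <+: c'.pos) : Mv C T' a ⟨c', a.rp, a.fr⟩ := by
  refine Mv.step a.cur c' a.rp a.rp a.fr hs hT hf ?_ ?_ ?_
  · intro p h; rw [hφ] at h; cases h
  · intro p h; rw [hφ] at h; cases h
  · intro p h; rfl

theorem form_moves (hT' : Red C T') {a : XS Q} (ha : XInv C T' a) {φ : PosBool (SMove × Q)}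
    (hφ : trn A V a.cur = .form φ) (mp : SMove × Q) (hmp : mp ∈ C.Y a.cur) :
    MoveX T' (fun c => ∃ b, Nx C T' a b ∧ xcfg b = c) a.cur.pos a.rp mp := by
  have hlv := C.lv _ ha.memS
  obtain ⟨m, p⟩ := mp
  have hhead := SInv.head ha
  cases m with
  | box =>
    intro i hi
    refine ⟨_, Or.inl (form_step hφ (Sc.box φ p i hφ hmp (hT'.sub hi)) hi ?_), rfl⟩
    intro F hF
    exact (hhead F hF).trans (List.prefix_append _ _)
  | dia =>
    by_cases hx : Exact C a.cur
    · have hi := hT'.exa _ ha.memS ha.memT hx φ p hφ hmp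
      refine ⟨_, hi, _, Or.inl (form_step hφ (Sc.dia φ p hφ hmp) hi ?_), rfl⟩
      intro F hF
      exact (hhead F hF).trans (List.prefix_append _ _)
    · obtain ⟨r, hr⟩ := hT'.gen _ ha.memS ha.memT hx φ p hφ hmp
      exact ⟨_, hr.kid, _, Or.inl (Mv.push a.cur a.rp a.fr φ p r hφ hmp hx hr), rfl⟩
  | up =>
    obtain ⟨h1, h2⟩ := hlv.up φ p hφ hmp
    refine ⟨h1, fun h => h2 (ha.vis.1 h), ?_⟩
    have hdT : a.cur.pos.dropLast ∈ T' := by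
      obtain ⟨y, e, he⟩ := (List.eq_nil_or_concat a.cur.pos).resolve_left h1
      rw [List.concat_eq_append] at he
      rw [he, List.dropLast_concat]
      exact hT'.pre y e (he ▸ ha.memT)
    by_cases hF : ∃ F ∈ a.fr.head?, a.cur.pos = F.e.pos
    · obtain ⟨F, hF, hpos⟩ := hF
      obtain ⟨c, rp, fr⟩ := a
      cases fr with
      | nil => simp at hF
      | cons F' fr =>
        simp at hF
        subst hF
        obtain ⟨e1, e2, e3⟩ := pop_facts hφ hmp hpos ha
        refine ⟨_, Or.inl (Mv.pop c rp F' fr φ p hφ hmp hpos), ?_⟩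
        simp only at e2 e3 ⊢
        simp only [xcfg, e3, ← e2]
    · refine ⟨_, Or.inl (form_step hφ (Sc.up φ p hφ hmp) hdT ?_), rfl⟩
      intro F hF'
      exact prefix_dropLast (hhead F hF') fun h => hF ⟨F, hF', h.symm⟩
  | stay =>
    exact ⟨_, Or.inl (form_step hφ (Sc.stay φ p hφ hmp) ha.memT hhead), rfl⟩
  | root =>
    exact ⟨hlv.root φ p hφ hmp,
      _, Or.inl (form_step hφ (Sc.root φ p hφ hmp) ha.memT hhead), rfl⟩

theorem drop_move {a : XS Q} (ha : XInv C T' a) {p : Q}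
    (hp : trn A V a.cur = .drop p) :
    ∃ b, Nx C T' a b ∧ xcfg b = ⟨p, a.cur.pos, a.rp ++ [a.cur.pos]⟩ := by
  refine ⟨_, Or.inl (Mv.step a.cur _ a.rp (a.rp ++ [a.cur.pos]) a.fr (Sc.drop p hp) ha.memT
    (fun F hF => SInv.head ha F hF) ?_ ?_ ?_), rfl⟩
  · intro p h; rfl
  · intro p h; rw [hp] at h; cases h
  · intro p h; rw [hp] at h; cases h

theorem lift_move {a : XS Q} (ha : XInv C T' a) {p : Q}
    (hp : trn A V a.cur = .lift p) :
    ∃ b, Nx C T' a b ∧ xcfg b = ⟨p, a.cur.pos, a.rp.dropLast⟩ := by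
  refine ⟨_, Or.inl (Mv.step a.cur _ a.rp a.rp.dropLast a.fr (Sc.lift p hp) ha.memT
    (fun F hF => SInv.head ha F hF) ?_ ?_ ?_), rfl⟩
  · intro p h; rw [hp] at h; cases h
  · intro p h; rfl
  · intro p h; rw [hp] at h; cases h

theorem x_loc (hT' : Red C T') {a : XS Q} (ha : XInv C T' a) :
    LocX A T' V (fun c => ∃ b, Nx C T' a b ∧ xcfg b = c) (xcfg a) := by
  have hlv := C.lv _ ha.memS
  have ht : trn A V (xcfg a) = trn A V a.cur := ha.trn_eq
  unfold LocX
  rw [ht]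
  refine ⟨ha.memT, ?_, ?_, ?_, ?_⟩
  · change a.rp.length ≤ k
    rw [ha.len]; exact hlv.len
  · intro p hp
    refine ⟨?_, drop_move ha hp⟩
    change a.rp.length < k
    rw [ha.len]; exact hlv.drop p hp
  · intro p hp
    exact ⟨ha.vis.2 (hlv.lift p hp), lift_move ha hp⟩
  · intro φ hφ
    exact ⟨C.Y a.cur, hlv.sat φ hφ, form_moves hT' ha hφ⟩

theorem x_dead (hT' : Red C T') {a : XS Q} (ha : XInv C T' a) (hd : ∀ b, ¬ Nx C T' a b) :
    TA A V (xcfg a) := by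
  have ht : trn A V (xcfg a) = trn A V a.cur := ha.trn_eq
  unfold TA
  rw [ht]
  by_contra hTA
  refine hd _ (Or.inr ⟨⟨?_, hTA⟩, rfl⟩)
  intro c' hc
  cases hc with
  | drop p ht => obtain ⟨b, hb, _⟩ := drop_move ha ht; exact hd b hb
  | lift p ht => obtain ⟨b, hb, _⟩ := lift_move ha ht; exact hd b hb
  | box φ p i ht hY hi =>
    obtain ⟨i', hi'⟩ := hT'.kid _ i ha.memT hi
    obtain ⟨b, hb, _⟩ := form_moves hT' ha ht _ hY i' hi'
    exact hd b hb
  | dia φ p ht hY =>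
    obtain ⟨_, _, b, hb, _⟩ := form_moves hT' ha ht _ hY
    exact hd b hb
  | up φ p ht hY =>
    obtain ⟨_, _, b, hb, _⟩ := form_moves hT' ha ht _ hY
    exact hd b hb
  | stay φ p ht hY =>
    obtain ⟨b, hb, _⟩ := form_moves hT' ha ht _ hY
    exact hd b hb
  | root φ p ht hY =>
    obtain ⟨_, b, hb, _⟩ := form_moves hT' ha ht _ hY
    exact hd b hb

/-! #### Acceptance -/

def InvK (C : Cert A T V) (a : XS Q) : Prop := a.cur ∈ C.K ∧ ∀ F ∈ a.fr, F.c ∈ C.K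

theorem Mv.invK {a b : XS Q} (hm : Mv C T' a b) (ha : XInv C T' a) (hk : InvK C a) :
    InvK C b := by
  have hi := hm.inv ha
  cases hm with
  | step c c' rp rp' fr hs hT hf h1 h2 h3 => exact ⟨C.closK c hk.1 c' hs, hk.2⟩
  | push c rp fr φ p r hφ hY hx hr =>
    refine ⟨?_, ?_⟩
    · refine C.low ⟨p, c.pos ++ [C.d c p], c.peb⟩ (C.closK c hk.1 _ (Sc.dia φ p hφ hY)) _ ?_ hr.rank
      exact hi.memS
    · intro F hF
      rcases List.mem_cons.1 hF with rfl | hF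
      · exact hk.1
      · exact hk.2 F hF
  | pop c rp F fr φ p hφ hY hp =>
    refine ⟨?_, fun F' hF' => hk.2 F' (List.mem_cons_of_mem _ hF')⟩
    obtain ⟨e1, e2, e3⟩ := pop_facts hφ hY hp ha
    have hFK := hk.2 F (by simp)
    by_cases hpq : p = F.c.st
    · subst hpq; exact hFK
    · have hw := C.closK c hk.1 _ e1
      have hval := ha.2.2.2.2.1.2.2.2.2.2.2
      exact (((hval p hpq).2 (C.hKS hw)).1).1 hw

theorem Mv.states {a b : XS Q} (hm : Mv C T' a b) (ha : XInv C T' a) :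
    b.cur.st ∈ (trn A V a.cur).states := by
  have hlv := C.lv _ ha.memS
  cases hm with
  | step c c' rp rp' fr hs hT hf h1 h2 h3 => exact sc_states hlv hs
  | push c rp fr φ p r hφ hY hx hr => exact sc_states (c' := ⟨p, c.pos ++ [C.d c p], c.peb⟩) hlv (Sc.dia φ p hφ hY)
  | pop c rp F fr φ p hφ hY hp => exact sc_states (c' := ⟨p, c.pos.dropLast, c.peb⟩) hlv (Sc.up φ p hφ hY)

theorem no_inf (g : ℕ → XS Q) (hinv : ∀ n, XInv C T' (g n)) (hm : ∀ n, Mv C T' (g n) (g (n + 1)))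
    (i : ℕ) (hi : ∀ n, A.idx (g n).cur.st = i)
    (hc : (A.cls i = .existential ∧ ∀ n, (g n).cur.st ∉ A.G) ∨ A.cls i = .universal) :
    ¬ ∀ m, ∃ n, m ≤ n ∧ (A.cls i = .existential ∨ (g n).cur.st ∈ A.B) := by
  have D : ∀ c c', c ∈ C.S → CSc C c c' → A.idx c.st = i → A.idx c'.st = i →
      (A.cls i = .existential → c.st ∉ A.G) →
      C.ρ c' ≤ C.ρ c ∧ ((A.cls i = .existential ∨ c.st ∈ A.B) → C.ρ c' < C.ρ c) := by
    intro c c' hcS hs h1 h2 hG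
    rcases C.rk c hcS c' hs (h2.trans h1.symm) with ⟨e1, e2⟩ | ⟨e1, e2, e3⟩
    · rw [h1] at e1
      have := e2.resolve_left (hG e1)
      exact ⟨this.le, fun _ => this⟩
    · rw [h1] at e1
      refine ⟨e2, fun h => e3 (h.resolve_left ?_)⟩
      rw [e1]; simp
  have hG : ∀ n, A.cls i = .existential → (g n).cur.st ∉ A.G := by
    intro n h
    rcases hc with hc | hc
    · exact hc.2 n
    · rw [h] at hc; cases hc
  refine stack_rank (fun n => (g n).fr.length) (fun n => C.ρ (g n).cur) _ ?_ ?_ ?_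
  · intro n
    have := hm n
    revert this
    generalize g n = a
    generalize g (n + 1) = b
    intro h
    cases h <;> simp
  · intro n hle
    have h1 := hm n
    have h2 := hinv n
    have h3 := hi n
    have h4 := hi (n + 1)
    have h5 := hG n
    have h6 := h1.inv h2
    revert h1 h2 h3 h4 h5 h6 hle
    generalize g n = a
    generalize g (n + 1) = b
    intro hle hm ha h3 h4 h5 h6
    cases hm with
    | step c c' rp rp' fr hs hT hf h1 h2 h3 => exact D c c' ha.memS hs (by assumption) (by assumption) h5
    | push c rp fr φ p r hφ hY hx hr =>
      have := D c _ ha.memS (Sc.dia φ p hφ hY) h3 h4 h5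
      exact ⟨hr.rank.trans this.1, fun h => hr.rank.trans_lt (this.2 h)⟩
    | pop c rp F fr φ p hφ hY hp => simp at hle
  · intro u t hut h1 h2 h3 h4
    -- the push at `u`
    have hpush : ∃ F, (g (u + 1)).fr = F :: (g u).fr ∧ F.c = (g u).cur ∧ F.e = (g (u + 1)).cur := by
      have h5 := hm u
      have h6 := h3 (u + 1) (by omega) (by omega)
      revert h5 h6
      generalize g u = a
      generalize g (u + 1) = b
      intro hm hlt
      cases hm with
      | step c c' rp rp' fr hs hT hf h1 h2 h3 => simp at hlt
      | push c rp fr φ p r hφ hY hx hr => exact ⟨_, rfl, rfl, rfl⟩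
      | pop c rp F fr φ p hφ hY hp => simp at hlt
    obtain ⟨F, hF1, hF2, hF3⟩ := hpush
    have hsuf : ∀ v, u + 1 ≤ v → v ≤ t → (F :: (g u).fr) <:+ (g v).fr := by
      intro v hv
      induction v, hv using Nat.le_induction with
      | base => intro _; rw [hF1]
      | succ v hv ih =>
        intro hvt
        have ih := ih (by omega)
        have h5 := hm v
        have h6 := h3 (v + 1) (by omega) hvt
        revert h5 h6 ih
        generalize g (v + 1) = b
        generalize g v = a
        intro ih hm hlt
        cases hm with
        | step c c' rp rp' fr hs hT hf h1 h2 h3 => exact ih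
        | push c rp fr φ p r hφ hY hx hr => exact ih.trans (List.suffix_cons _ _)
        | pop c rp F' fr φ p hφ hY hp =>
          rcases List.suffix_cons_iff.1 ih with h | h
          · exfalso
            have := congrArg List.length h
            simp at this hlt
            omega
          · exact h
    have hfrt : (g t).fr = F :: (g u).fr := by
      refine ((hsuf t (by omega) le_rfl).eq_of_length ?_).symm
      simp [h2]
    have hIt := hinv t
    have hIu := hinv u
    have hmt := hm t
    have hit := hi t
    have hit1 := hi (t + 1)
    have hGt := hG t
    have hiu := hi u
    have hiu1 := hi (u + 1)
    have hGu := hG u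
    revert hmt hIt hit hit1 hGt h4 h1 h2 hfrt
    generalize g (t + 1) = b
    generalize g t = a
    intro h1 h2 h4 hfrt hIt hmt hit hit1 hGt
    cases hmt with
    | step c c' rp rp' fr hs hT hf h1' h2' h3' => simp at h1 h2; omega
    | push c rp fr φ p r hφ hY hx hr => simp at h1 h2; omega
    | pop c rp F' fr φ p hφ hY hp =>
      simp only at *
      obtain ⟨rfl, rfl⟩ := List.cons.inj hfrt
      obtain ⟨e1, e2, e3⟩ := pop_facts hφ hY hp hIt
      have fok := hIt.2.2.2.2.1
      obtain ⟨_, _, _, _, k1, k2, k3⟩ := fok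
      rw [hF2] at e1 k1 k2 k3
      have d1 := D c _ hIt.memS e1 hit hit1 hGt
      have d2 := D _ _ k1 k2 hiu (by rw [hF3]; exact hiu1) hGu
      rw [hF2]
      rw [← hF3] at h4 ⊢
      by_cases hpq : p = (g u).cur.st
      · subst hpq
        refine ⟨le_rfl, fun hfl => ?_⟩
        exfalso
        rcases hfl with h | h | h
        · exact absurd (d1.1.trans h4) (not_le.2 (d2.2 h))
        · exact absurd (h4.trans d2.1) (not_le.2 (d1.2 h))
        · exact absurd (d1.1.trans_lt (h.trans_le d2.1)) (lt_irrefl _)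
      · have hw : (⟨p, (g u).cur.pos, F'.e.peb⟩ : Config Q) ∈ C.S := C.clos c hIt.memS _ e1
        have hcmp := ((k3 p hpq).2 hw).2
        have hle : C.ρ ⟨p, (g u).cur.pos, F'.e.peb⟩ ≤ C.ρ ⟨(g u).cur.st, (g u).cur.pos, F'.e.peb⟩ :=
          d1.1.trans (h4.trans d2.1)
        refine ⟨(cmp_eq_cmp_iff_le hcmp).1 hle, fun hfl => ?_⟩
        refine (cmp_eq_cmp_iff_lt hcmp).1 ?_
        rcases hfl with h | h | h
        · exact (d1.1.trans h4).trans_lt (d2.2 h)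
        · exact (d1.2 h).trans_le (h4.trans d2.1)
        · exact d1.1.trans_lt (h.trans_le d2.1)

end


section
variable {Q σ : Type} {k : ℕ} {A : SWPHAA Q σ k} {T : Set (List ℕ)} {V : List ℕ → σ}
variable {C : Cert A T V} {T' : Set (List ℕ)}

theorem x_acc (hhes : Hesitant A) (f : ℕ → XS Q) (hinv : ∀ n, XInv C T' (f n))
    (hN : ∀ n, Nx C T' (f n) (f (n + 1))) : AccBranch A (fun n => (xcfg (f n)).st) := by
  classical
  change AccBranch A (fun n => (f n).cur.st)
  let TP : ℕ → Prop := fun n => CVac C (f n).cur ∧ f (n + 1) = ⟨C.cs, C.cs.peb, []⟩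
  by_cases hinf : ∀ m, ∃ n, m ≤ n ∧ TP n
  · obtain ⟨n0, -, h0⟩ := hinf 0
    have hK0 : ∀ n, TP n → InvK C (f (n + 1)) := by
      intro n hn
      rw [hn.2]
      exact ⟨C.hcs, by simp⟩
    have hK : ∀ n, n0 + 1 ≤ n → InvK C (f n) := by
      intro n hn
      induction n, hn using Nat.le_induction with
      | base => exact hK0 _ h0
      | succ n hn ih =>
        rcases hN n with h | h
        · exact h.invK (hinv n) ih
        · exact hK0 n h
    obtain ⟨i, hi, hcore⟩ := C.core
    refine ⟨i, n0 + 1, fun n hn => hi _ (hK n hn).1, ?_⟩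
    rcases hcore with ⟨h1, h2⟩ | ⟨h1, h2⟩ | h
    · exact Or.inr ⟨h1, n0 + 1, fun n hn => h2 _ (hK n hn).1⟩
    · refine Or.inl ⟨h1, fun m => ?_⟩
      obtain ⟨n, hn, ht⟩ := hinf m
      refine ⟨n + 1, by omega, ?_⟩
      change (f (n + 1)).cur.st ∈ A.G
      rw [ht.2]; exact h2
    · obtain ⟨n, hn, ht⟩ := hinf (n0 + 1)
      exact absurd ht.1 (h _ (hK n hn).1)
  · push Not at hinf
    obtain ⟨m0, hm0⟩ := hinf
    have hM : ∀ n, m0 ≤ n → Mv C T' (f n) (f (n + 1)) := fun n hn =>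
      (hN n).resolve_right (hm0 n hn)
    have hmono : ∀ n, m0 ≤ n → A.idx (f (n + 1)).cur.st ≤ A.idx (f n).cur.st := fun n hn =>
      hhes.1 _ _ _ _ ((hM n hn).states (hinv n))
    obtain ⟨N, hN0, hNmin⟩ := (InvImage.wf (fun n => A.idx (f n).cur.st) Nat.lt_wfRel.wf).has_min
      {n | m0 ≤ n} ⟨m0, le_refl m0⟩
    have hconst : ∀ n, N ≤ n → A.idx (f n).cur.st = A.idx (f N).cur.st := by
      intro n hn
      refine le_antisymm ?_ (not_lt.1 (hNmin n (le_trans hN0 hn)))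
      induction n, hn using Nat.le_induction with
      | base => exact le_rfl
      | succ n hn ih => exact (hmono n (le_trans hN0 hn)).trans ih
    refine ⟨A.idx (f N).cur.st, N, hconst, ?_⟩
    cases hc : A.cls (A.idx (f N).cur.st) with
    | existential =>
      refine Or.inl ⟨rfl, ?_⟩
      by_contra hG
      push Not at hG
      obtain ⟨m, hm⟩ := hG
      refine no_inf (fun n => f (n + (N + m))) (fun n => hinv _) (fun n => ?_) _
        (fun n => hconst _ (by omega)) (Or.inl ⟨hc, fun n => hm _ (by omega)⟩)
        (fun m => ⟨m, le_rfl, Or.inl hc⟩)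
      have := hM (n + (N + m)) (le_trans hN0 (by omega))
      rwa [show n + (N + m) + 1 = n + 1 + (N + m) by omega] at this
    | universal =>
      refine Or.inr ⟨rfl, ?_⟩
      by_contra hB
      push Not at hB
      refine no_inf (fun n => f (n + N)) (fun n => hinv _) (fun n => ?_) _
        (fun n => hconst _ (by omega)) (Or.inr hc) (fun m => ?_)
      · have := hM (n + N) (le_trans hN0 (by omega))
        rwa [show n + N + 1 = n + 1 + N by omega] at this
      · obtain ⟨n, hn, h⟩ := hB (m + N)
        obtain ⟨j, rfl⟩ := Nat.exists_eq_add_of_le hn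
        refine ⟨m + j, by omega, Or.inr ?_⟩
        rwa [show m + j + N = m + N + j by omega]
    | transient =>
      exact absurd (hconst (N + 1) (by omega))
        (hhes.2.1 _ _ _ hc _ ((hM N hN0).states (hinv N)))

theorem accepts_of_red [Countable Q] (hhes : Hesitant A) (hT' : Red C T') : SAccepts A T' V := by
  refine unravel A T' V (X := XS Q) xcfg (Nx C T') ⟨⟨A.q0, [], []⟩, [], []⟩ (XInv C T') ?_ ?_ rfl
    (fun a ha => x_loc hT' ha) (fun f _ h1 h2 => x_acc hhes f h1 h2) (fun a ha h => x_dead hT' ha h)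
  · exact ⟨C.hroot, hT'.nil, rfl⟩
  · intro a b ha hab
    exact hab.inv hT' ha

end


/-! ### Part 6: the reduced tree -/

abbrev KeyT (Q : Type) (k : ℕ) : Type :=
  (Fin (k + 1) × Q × Q) ⊕ (Fin k × (Σ q : Q, Q × ({r : Q // r ≠ q} → Option (Bool × Ordering)))) ⊕
    Unit

theorem arith_bound (n k : ℕ) (hn : 1 ≤ n) :
    (k + 1) * (n * n) + (k * (n * (n * 7 ^ (n - 1))) + 1) ≤ 2 ^ (n ^ 2 * (k + 1)) := by
  obtain ⟨m, rfl⟩ : ∃ m, n = m + 1 := ⟨n - 1, by omega⟩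
  simp only [Nat.add_sub_cancel]
  rw [pow_mul]
  set P := 2 ^ ((m + 1) ^ 2) with hP
  have h1 : (m + 1) * (m + 1) + 1 ≤ P := by
    have : (m + 1) ^ 2 < 2 ^ ((m + 1) ^ 2) := Nat.lt_two_pow_self
    rw [hP]; nlinarith
  have h2 : 7 ^ m + 1 ≤ P := by
    have e1 : 2 ^ (3 * m + 1) ≤ P := by
      rw [hP]
      refine Nat.pow_le_pow_right (by norm_num) ?_
      rcases Nat.eq_zero_or_pos m with rfl | h
      · norm_num
      · nlinarith
    have e2 : 7 ^ m ≤ 8 ^ m := Nat.pow_le_pow_left (by norm_num) m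
    have e3 : 2 ^ (3 * m + 1) = 2 * 8 ^ m := by
      rw [pow_succ, pow_mul]; norm_num; ring
    have e4 : 1 ≤ 8 ^ m := Nat.one_le_pow _ _ (by norm_num)
    omega
  obtain ⟨R, hR⟩ : ∃ R, P = R + 1 := ⟨P - 1, by omega⟩
  rw [hR] at h1 h2 ⊢
  generalize (m + 1) = n at *
  have h1' : n * n ≤ R := by omega
  generalize 7 ^ m = s at *
  have h2' : s ≤ R := by omega
  have h3 : n * n + n * (n * s) ≤ (R + 1) * R := by
    have : n * (n * s) = n * n * s := by ring
    rw [this]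
    calc n * n + n * n * s = n * n * (s + 1) := by ring
      _ ≤ R * (R + 1) := Nat.mul_le_mul h1' (by omega)
      _ = _ := by ring
  have h4 : ∀ k, (R + 1) + k * ((R + 1) * R) ≤ (R + 1) ^ (k + 1) := by
    intro k
    induction k with
    | zero => simp
    | succ k ih =>
      have e : (R + 1) ≤ (R + 1) ^ (k + 1) := by
        calc (R + 1) = (R + 1) ^ 1 := by ring
          _ ≤ _ := Nat.pow_le_pow_right (by omega) (by omega)
      calc (R + 1) + (k + 1) * ((R + 1) * R) = ((R + 1) + k * ((R + 1) * R)) + (R + 1) * R := by ring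
        _ ≤ (R + 1) ^ (k + 1) + (R + 1) ^ (k + 1) * R := by
          exact Nat.add_le_add ih (Nat.mul_le_mul_right _ e)
        _ = (R + 1) ^ (k + 1 + 1) := by ring
  have h5 : k * (n * n + n * (n * s)) ≤ k * ((R + 1) * R) := Nat.mul_le_mul_left k h3
  calc (k + 1) * (n * n) + (k * (n * (n * s)) + 1)
      = n * n + 1 + k * (n * n + n * (n * s)) := by ring
    _ ≤ (R + 1) + k * ((R + 1) * R) := by omega
    _ ≤ _ := h4 k

theorem key_card (Q : Type) [Fintype Q] [DecidableEq Q] [Nonempty Q] (k : ℕ) :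
    Fintype.card (KeyT Q k) ≤ 2 ^ (Fintype.card Q ^ 2 * (k + 1)) := by
  have hO : Fintype.card Ordering = 3 := rfl
  have : Fintype.card (KeyT Q k) = (k + 1) * (Fintype.card Q * Fintype.card Q) +
      (k * (Fintype.card Q * (Fintype.card Q * 7 ^ (Fintype.card Q - 1))) + 1) := by
    unfold KeyT
    simp only [Fintype.card_sum, Fintype.card_prod, Fintype.card_fin, Fintype.card_sigma,
      Fintype.card_fun, Fintype.card_option, Fintype.card_bool, hO, Fintype.card_unit]
    have : ∀ q : Q, Fintype.card {r : Q // r ≠ q} = Fintype.card Q - 1 := by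
      intro q
      rw [Fintype.card_subtype_compl]; simp
    simp only [this, Finset.sum_const, Finset.card_univ, smul_eq_mul]
  rw [this]
  exact arith_bound _ _ Fintype.card_pos

section
variable {Q σ : Type} {k : ℕ} {A : SWPHAA Q σ k} {T : Set (List ℕ)} {V : List ℕ → σ}

open Classical in
noncomputable def valOf (C : Cert A T V) (q : Q) (x : List ℕ) (τ : List (List ℕ)) :
    {r : Q // r ≠ q} → Option (Bool × Ordering) := fun r =>
  if (⟨r.1, x, τ⟩ : Config Q) ∈ C.S then
    some (decide ((⟨r.1, x, τ⟩ : Config Q) ∈ C.K), cmp (C.ρ ⟨r.1, x, τ⟩) (C.ρ ⟨q, x, τ⟩))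
  else none

theorem valEq_of {C : Cert A T V} {q : Q} {x : List ℕ} {τ τ' : List (List ℕ)}
    (h : valOf C q x τ = valOf C q x τ') : ValEq C q x τ τ' := by
  intro q' hq
  have := congrFun h ⟨q', hq⟩
  unfold valOf at this
  simp only at this
  by_cases h1 : (⟨q', x, τ⟩ : Config Q) ∈ C.S <;> by_cases h2 : (⟨q', x, τ'⟩ : Config Q) ∈ C.S
  · simp only [h1, h2, if_true, Option.some.injEq, Prod.mk.injEq, decide_eq_decide] at this
    exact ⟨⟨fun _ => h2, fun _ => h1⟩, fun _ => this⟩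
  · simp [h1, h2] at this
  · simp [h1, h2] at this
  · exact ⟨⟨fun h => absurd h h1, fun h => absurd h h2⟩, fun h => absurd h h1⟩

structure Cand (C : Cert A T V) (x : List ℕ) (l : ℕ) (q p : Q)
    (v : {r : Q // r ≠ q} → Option (Bool × Ordering)) (r : Config Q) : Prop where
  mem : r ∈ C.S
  pos : r.pos = x
  st : r.st = q
  len : r.peb.length = l + 1
  form : ∃ φ, trn A V r = .form φ
  dia : (SMove.dia, p) ∈ C.Y r
  nex : ¬ Exact C r
  val : valOf C q x r.peb = v

theorem cand_min (C : Cert A T V) (x : List ℕ) (l : ℕ) (q p : Q)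
    (v : {r : Q // r ≠ q} → Option (Bool × Ordering)) :
    ∃ r, ∀ r', Cand C x l q p v r' → Cand C x l q p v r ∧
      C.ρ ⟨p, x ++ [C.d r p], r.peb⟩ ≤ C.ρ ⟨p, x ++ [C.d r' p], r'.peb⟩ := by
  by_cases h : ∃ r', Cand C x l q p v r'
  · obtain ⟨r, hr, hmin⟩ := (InvImage.wf (fun r : Config Q => C.ρ ⟨p, x ++ [C.d r p], r.peb⟩)
      Ordinal.lt_wf).has_min {r | Cand C x l q p v r} h
    exact ⟨r, fun r' hr' => ⟨hr, not_lt.1 (hmin r' hr')⟩⟩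
  · exact ⟨C.cs, fun r' hr' => absurd ⟨r', hr'⟩ h⟩

open Classical in
noncomputable def sel (C : Cert A T V) (x : List ℕ) : KeyT Q k → ℕ
  | .inl (j, q, p) => C.d ⟨q, x, C.cs.peb.take j⟩ p
  | .inr (.inl (l, ⟨q, p, v⟩)) => C.d (cand_min C x l q p v).choose p
  | .inr (.inr _) => if h : ∃ i, x ++ [i] <+: C.cs.pos then h.choose else 0

def redT (C : Cert A T V) : Set (List ℕ) :=
  {x | x ∈ T ∧ ∀ u i, u ++ [i] <+: x → ∃ κ, sel C u κ = i}

theorem redT_app {C : Cert A T V} (hT : IsTree T) (x : List ℕ) (i : ℕ) :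
    x ++ [i] ∈ redT C ↔ x ∈ redT C ∧ x ++ [i] ∈ T ∧ ∃ κ, sel C x κ = i := by
  constructor
  · rintro ⟨h1, h2⟩
    exact ⟨⟨hT.2.1 _ _ h1, fun u j hu => h2 u j (hu.trans (List.prefix_append _ _))⟩, h1,
      h2 x i (List.prefix_refl _)⟩
  · rintro ⟨⟨h1, h2⟩, h3, h4⟩
    refine ⟨h3, fun u j hu => ?_⟩
    rcases List.prefix_concat_iff.1 hu with h | h
    · obtain ⟨rfl, h⟩ := List.append_inj' h rfl
      simp at h
      subst h
      exact h4
    · exact h2 u j h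

theorem tree_pre (hT : IsTree T) : ∀ y x : List ℕ, x <+: y → y ∈ T → x ∈ T := by
  intro y
  induction y using List.reverseRecOn with
  | nil => intro x hx hy; simp at hx; subst hx; exact hy
  | append_singleton y c ih =>
    intro x hx hy
    rcases List.prefix_concat_iff.1 hx with h | h
    · subst h; exact hy
    · exact ih x h (hT.2.1 _ _ hy)

theorem redT_red (C : Cert A T V) (hT : IsTree T) : Red C (redT C) where
  sub := fun x hx => hx.1
  nil := ⟨hT.1, fun u i h => by simp at h⟩
  pre := fun x i h => ((redT_app hT x i).1 h).1
  cs := by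
    refine ⟨(C.lv _ (C.hKS C.hcs)).pos, fun u i h => ⟨.inr (.inr ()), ?_⟩⟩
    have hex : ∃ i, u ++ [i] <+: C.cs.pos := ⟨i, h⟩
    simp only [sel, dif_pos hex]
    have h2 := hex.choose_spec
    have := (List.prefix_of_prefix_length_le h2 h (by simp)).eq_of_length (by simp)
    simpa using this
  kid := by
    intro x i hx hi
    refine ⟨sel C x (.inr (.inr ())), (redT_app hT _ _).2 ⟨hx, ?_, _, rfl⟩⟩
    by_cases hex : ∃ i, x ++ [i] <+: C.cs.pos
    · simp only [sel, dif_pos hex]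
      exact tree_pre hT _ _ hex.choose_spec (C.lv _ (C.hKS C.hcs)).pos
    · simp only [sel, dif_neg hex]
      rcases Nat.eq_zero_or_pos i with rfl | h
      · exact hi
      · exact hT.2.2 _ _ _ hi h
  exa := by
    intro c hc hcT hx φ p hφ hY
    have hlv := C.lv c hc
    refine (redT_app hT _ _).2 ⟨hcT, hlv.dia φ p hφ hY,
      .inl (⟨c.peb.length, Nat.lt_succ_of_le hlv.len⟩, c.st, p), ?_⟩
    simp only [sel]
    rw [← show c.peb = _ from hx]
  gen := by
    intro c hc hcT hx φ p hφ hY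
    have hlv := C.lv c hc
    obtain ⟨l, hl, _⟩ := nonexact_top hc hx
    have hpos : 0 < c.peb.length := by
      rw [List.length_pos_iff]
      rintro h
      rw [h] at hl
      simp at hl
    let l : Fin k := ⟨c.peb.length - 1, by have := hlv.len; omega⟩
    have hcand : Cand C c.pos l c.st p (valOf C c.st c.pos c.peb) c :=
      ⟨hc, rfl, rfl, by simp only [l]; omega, ⟨φ, hφ⟩, hY, hx, rfl⟩
    obtain ⟨h1, h2⟩ := (cand_min C c.pos l c.st p (valOf C c.st c.pos c.peb)).choose_spec c hcand
    refine ⟨(cand_min C c.pos l c.st p (valOf C c.st c.pos c.peb)).choose, ?_⟩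
    have hsel : sel C c.pos (.inr (.inl (l, ⟨c.st, p, valOf C c.st c.pos c.peb⟩))) =
      C.d (cand_min C c.pos l c.st p (valOf C c.st c.pos c.peb)).choose p := rfl
    revert h1 h2 hsel
    generalize (cand_min C c.pos l c.st p (valOf C c.st c.pos c.peb)).choose = r
    intro h1 h2 hsel
    obtain ⟨φ', hφ'⟩ := h1.form
    have hrT := (C.lv r h1.mem).dia φ' p hφ' h1.dia
    rw [h1.pos] at hrT
    refine ⟨h1.mem, h1.st, h1.pos, ?_, h1.form, h1.dia,
      (redT_app hT _ _).2 ⟨hcT, hrT, _, hsel⟩, ?_, h2, valEq_of h1.val⟩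
    · rw [h1.len]; simp only [l]; omega
    · intro l' hl'
      obtain ⟨l'', e1, e2⟩ := nonexact_top h1.mem h1.nex
      rw [hl'] at e1
      cases e1
      rw [← h1.pos]; exact e2

end

theorem stmt9_core {Q σ : Type} [Fintype Q] {k : ℕ} (A : SWPHAA Q σ k)
    (hhes : Hesitant A)
    (hne : ∃ T V, IsTree T ∧ SAccepts A T V) :
    ∃ T V, IsTree T ∧ SAccepts A T V ∧
      ∀ x : List ℕ, x ++ [2 ^ ((Fintype.card Q) ^ 2 * (k + 1))] ∉ T := by
  classical
  obtain ⟨T, V, hT, hacc⟩ := hne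
  obtain ⟨C⟩ := cert_of_accepts hhes hacc
  have hred := redT_red C hT
  have hacc' := accepts_of_red hhes hred
  have : Nonempty Q := ⟨A.q0⟩
  refine renumber A (redT C) V _ hred.nil hred.pre ?_ hacc'
  intro x
  refine ⟨Finset.univ.image (sel C x), ?_, ?_⟩
  · exact (Finset.card_image_le).trans (by rw [Finset.card_univ]; exact key_card Q k)
  · intro c hc
    obtain ⟨_, _, κ, hκ⟩ := (redT_app hT x c).1 hc
    exact Finset.mem_image.2 ⟨κ, Finset.mem_univ _, hκ⟩

/-- a symmetric k-weak-pebble hesitant alternating tree automaton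
with `n` states that accepts some tree accepts a tree of branching degree at
most `2^(n²·(k+1))` (a node has at most `N` children iff `x ++ [N] ∉ T`). -/
theorem stmt9 {Q σ : Type} [Fintype Q] {k : ℕ} (A : SWPHAA Q σ k)
    (hwf : WellFormed A) (hhes : Hesitant A)
    (hne : ∃ T V, IsTree T ∧ SAccepts A T V) :
    ∃ T V, IsTree T ∧ SAccepts A T V ∧
      ∀ x : List ℕ, x ++ [2 ^ ((Fintype.card Q) ^ 2 * (k + 1))] ∉ T := by
  exact stmt9_core A hhes hne
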